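/- arXiv:2307.07833 — 2 statements merged into one kernel-verified Lean document; each statement's English description precedes it below -/
import Mathlib

section
/- For every j ∈ [N], the matrix A* maps the eigenspace of A for the eigenvalue θ_j into the sum of the eigenspaces of A for the eigenvalues θ_k over those k ∈ [N] with |k − j| ≤ 1. Equivalently, E_i A* E_j = 0 for all i, j ∈ [N] with i − j ∉ {1, 0, −1}, where E_k denotes the spectral projection of A onto the eigenspace for θ_k. -/
open Module Matrix Finset

noncomputable section

open scoped Classical

variable {F H : Type} [Field F] [Fintype F] [AddCommGroup H] [Module F H]
  [FiniteDimensional F H]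

/-- The vertex set of the Attenuated Space poset `A_q(N,M)`:
the subspaces of `H` that intersect `h` trivially. -/
def AttX (h : Submodule F H) := {y : Submodule F H // y ⊓ h = ⊥}

instance (h : Submodule F H) : Fintype (AttX h) := by
  have : Finite H := Module.finite_of_finite F
  have : Finite (Submodule F H) :=
    Finite.of_injective (fun y : Submodule F H => (y : Set H)) SetLike.coe_injective
  have : Finite (AttX h) := Subtype.finite
  exact Fintype.ofFinite _

/-- The dimension of a vertex. -/
def vdim (h : Submodule F H) (y : AttX h) : ℕ := finrank F (y.1 : Submodule F H)

/-- `AttCovers h y z` means that `z` covers `y`: `y ⊆ z` and `dim z = dim y + 1`. -/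
def AttCovers (h : Submodule F H) (y z : AttX h) : Prop :=
  y.1 ≤ z.1 ∧ vdim h z = vdim h y + 1

/-- The raising matrix `R`: `(y,z)`-entry `1` if `y` covers `z`, else `0`. -/
def Rmat (h : Submodule F H) : Matrix (AttX h) (AttX h) ℂ :=
  fun y z => if AttCovers h z y then 1 else 0

/-- The lowering matrix `L'`: `(y,z)`-entry `1` if `z` covers `y`, else `0`. -/
def Lpmat (h : Submodule F H) : Matrix (AttX h) (AttX h) ℂ :=
  fun y z => if AttCovers h y z then 1 else 0

/-- The `q`-lowering matrix `L`: `(y,z)`-entry `q^(dim y)` if `z` covers `y`, else `0`. -/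
def Lmat (h : Submodule F H) (q : ℕ) : Matrix (AttX h) (AttX h) ℂ :=
  fun y z => if AttCovers h y z then (q : ℂ) ^ (vdim h y) else 0

/-- The `q`-adjacency matrix `A`: `(y,z)`-entry `1` if `y` covers `z`,
`q^(dim y)` if `z` covers `y`, and `0` otherwise. -/
def Amat (h : Submodule F H) (q : ℕ) : Matrix (AttX h) (AttX h) ℂ :=
  fun y z =>
    if AttCovers h z y then 1 else if AttCovers h y z then (q : ℂ) ^ (vdim h y) else 0

/-- The dual adjacency matrix `A*`: diagonal with `(y,y)`-entry `q^{-dim y}`. -/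
def Astar (h : Submodule F H) (q : ℕ) : Matrix (AttX h) (AttX h) ℂ :=
  Matrix.diagonal fun y => (q : ℂ) ^ (-(vdim h y : ℤ))

/-- The matrix `S`: diagonal with `(y,y)`-entry `(-1)^(dim y)`. -/
def Smat (h : Submodule F H) : Matrix (AttX h) (AttX h) ℂ :=
  Matrix.diagonal fun y => (-1 : ℂ) ^ (vdim h y)

/-- The matrix `E*_i`: diagonal with `(y,y)`-entry `1` if `dim y = i`, else `0`. -/
def Estar (h : Submodule F H) (i : ℕ) : Matrix (AttX h) (AttX h) ℂ :=
  Matrix.diagonal fun y => if vdim h y = i then (1 : ℂ) else 0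

/-- The eigenvalue `θ_i` for `i = k/2 ∈ [N] = {0, 1/2, 1, …, N}` (so `k = 0,…,2N`):
`θ_i = (q^(N-i) - q^i)/(q - 1) · q^(M/2)`, written via `√q`. -/
def theta (q N M k : ℕ) : ℝ :=
  (Real.sqrt q ^ (2 * N - k) - Real.sqrt q ^ k) / ((q : ℝ) - 1) * Real.sqrt q ^ M

/-- The eigenspace of the `q`-adjacency matrix `A` for the eigenvalue `θ_{k/2}`. -/
def eigA (h : Submodule F H) (q N M k : ℕ) : Submodule ℂ (AttX h → ℂ) :=
  Module.End.eigenspace (Matrix.toLin' (Amat h q)) ((theta q N M k : ℝ) : ℂ)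

set_option linter.unusedSectionVars false

/-- A set of covers of `x` in the poset is counted through the vectors lying above `x`. -/
theorem card_mem_not_mem [Fintype H] {x w : Submodule F H} (hxw : x ≤ w) :
    #{u : H | u ∈ w ∧ u ∉ x} + Fintype.card F ^ finrank F x = Fintype.card F ^ finrank F w := by
  have key : ∀ y : Submodule F H, #{u : H | u ∈ y} = Fintype.card F ^ finrank F y := by
    intro y
    rw [← Module.card_eq_pow_finrank (K := F) (V := y), Fintype.card_subtype]
  rw [← key x, ← key w, ← Finset.card_union_of_disjoint]
  · congr 1
    ext u
    simp only [mem_union, mem_filter, mem_univ, true_and]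
    constructor
    · rintro (hu | hu)
      exacts [hu.1, hxw hu]
    · intro hu
      by_cases hx : u ∈ x <;> simp [hu, hx]
  · rw [Finset.disjoint_left]
    intro u hu hu'
    simp only [mem_filter, mem_univ, true_and] at hu hu'
    exact hu.2 hu'

theorem finrank_sup_span_singleton {x : Submodule F H} {u : H} (hu : u ∉ x) :
    finrank F (x ⊔ Submodule.span F {u} : Submodule F H) = finrank F x + 1 := by
  have hu0 : u ≠ 0 := by
    rintro rfl
    exact hu x.zero_mem
  have hd : x ⊓ Submodule.span F {u} = ⊥ := by
    rw [← disjoint_iff, Submodule.disjoint_span_singleton' hu0]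
    exact hu
  have := Submodule.finrank_sup_add_finrank_inf_eq x (Submodule.span F {u})
  rw [hd, finrank_bot, finrank_span_singleton hu0] at this
  simpa using this

theorem eq_sup_span_singleton_of_attCovers {h : Submodule F H} {x y : AttX h}
    (hxy : AttCovers h x y) {u : H} (hu : u ∈ y.1) (hux : u ∉ x.1) :
    x.1 ⊔ Submodule.span F {u} = y.1 := by
  refine Submodule.eq_of_le_of_finrank_eq ?_ ?_
  · exact sup_le hxy.1 ((Submodule.span_singleton_le_iff_mem _ _).2 hu)
  · rw [finrank_sup_span_singleton hux]
    exact hxy.2.symm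

theorem sup_span_singleton_inf_eq_bot {h x : Submodule F H} (hx : x ⊓ h = ⊥) {u : H}
    (hu : u ∉ x ⊔ h) : (x ⊔ Submodule.span F {u}) ⊓ h = ⊥ := by
  rw [eq_bot_iff]
  rintro v ⟨hv, hvh⟩
  obtain ⟨a, ha, b, hb, rfl⟩ := Submodule.mem_sup.1 hv
  obtain ⟨c, rfl⟩ := Submodule.mem_span_singleton.1 hb
  by_cases hc : c = 0
  · subst hc
    rw [← hx]
    simp only [zero_smul, add_zero] at hvh ⊢
    exact ⟨ha, hvh⟩
  · refine absurd ?_ hu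
    have hcu : c • u ∈ x ⊔ h := by
      have := (x ⊔ h).sub_mem (Submodule.mem_sup_right hvh) (Submodule.mem_sup_left ha)
      simpa using this
    exact (Submodule.smul_mem_iff _ hc).1 hcu

/-- The number of covers of `x` inside a subspace `Y`. -/
theorem card_attCovers_le {h : Submodule F H} (x : AttX h) {Y : Submodule F H} (hxY : x.1 ≤ Y) :
    #{y : AttX h | AttCovers h x y ∧ y.1 ≤ Y} * (Fintype.card F - 1)
        + Fintype.card F ^ finrank F (Y ⊓ h : Submodule F H)
      = Fintype.card F ^ (finrank F Y - vdim h x) := by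
  have : Finite H := Module.finite_of_finite F
  have : Fintype H := Fintype.ofFinite H
  set q := Fintype.card F
  set T : Finset (AttX h) := {y : AttX h | AttCovers h x y ∧ y.1 ≤ Y} with hT
  have hq : 1 < q := Fintype.one_lt_card
  have hunion : T.biUnion (fun y => {u : H | u ∈ y.1 ∧ u ∉ x.1})
      = ({u : H | u ∈ Y ∧ u ∉ x.1 ⊔ (Y ⊓ h)} : Finset H) := by
    ext u
    simp only [hT, mem_biUnion, mem_filter, mem_univ, true_and]
    constructor
    · rintro ⟨y, ⟨hxy, hyY⟩, huy, hux⟩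
      refine ⟨hyY huy, fun hu => hux ?_⟩
      obtain ⟨a, ha, b, hb, rfl⟩ := Submodule.mem_sup.1 hu
      have hby : b ∈ y.1 ⊓ h := by
        refine ⟨?_, hb.2⟩
        have := y.1.sub_mem huy (hxy.1 ha)
        simpa using this
      rw [y.2, Submodule.mem_bot] at hby
      simpa [hby] using ha
    · rintro ⟨huY, hu⟩
      have hux : u ∉ x.1 := fun hux => hu (Submodule.mem_sup_left hux)
      have huh : u ∉ x.1 ⊔ h := by
        intro hu'
        refine hu ?_
        have : u ∈ (x.1 ⊔ h) ⊓ Y := ⟨hu', huY⟩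
        rwa [sup_inf_assoc_of_le _ hxY, inf_comm] at this
      refine ⟨⟨x.1 ⊔ Submodule.span F {u}, sup_span_singleton_inf_eq_bot x.2 huh⟩,
        ⟨⟨le_sup_left, finrank_sup_span_singleton hux⟩,
          sup_le hxY ((Submodule.span_singleton_le_iff_mem _ _).2 huY)⟩, ?_, hux⟩
      exact Submodule.mem_sup_right (Submodule.mem_span_singleton_self u)
  have hdisj : (T : Set (AttX h)).PairwiseDisjoint
      (fun y => ({u : H | u ∈ y.1 ∧ u ∉ x.1} : Finset H)) := by
    intro y hy y' hy' hne
    rw [Function.onFun, Finset.disjoint_left]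
    intro u hu hu'
    simp only [hT, coe_filter, mem_filter, mem_univ, true_and, Set.mem_ofPred_eq] at hu hu' hy hy'
    refine hne (Subtype.ext ?_)
    rw [← eq_sup_span_singleton_of_attCovers hy.1 hu.1 hu.2,
      eq_sup_span_singleton_of_attCovers hy'.1 hu'.1 hu'.2]
  have hcard := Finset.card_biUnion hdisj
  rw [hunion] at hcard
  have hfib : ∀ y ∈ T, #{u : H | u ∈ y.1 ∧ u ∉ x.1} = (q - 1) * q ^ vdim h x := by
    intro y hy
    simp only [hT, mem_filter, mem_univ, true_and] at hy
    have h1 := card_mem_not_mem hy.1.1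
    have h2 : finrank F y.1 = vdim h x + 1 := hy.1.2
    rw [h2, pow_succ'] at h1
    rw [Nat.sub_mul, one_mul]
    exact Nat.eq_sub_of_add_eq h1
  rw [Finset.sum_congr rfl hfib, Finset.sum_const, smul_eq_mul] at hcard
  have htot := card_mem_not_mem (x := x.1 ⊔ (Y ⊓ h)) (w := Y) (sup_le hxY inf_le_left)
  have hdim : finrank F (x.1 ⊔ (Y ⊓ h) : Submodule F H)
      = vdim h x + finrank F (Y ⊓ h : Submodule F H) := by
    have h3 := Submodule.finrank_sup_add_finrank_inf_eq x.1 (Y ⊓ h)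
    have h4 : x.1 ⊓ (Y ⊓ h) = ⊥ := by
      rw [eq_bot_iff]
      exact le_trans (inf_le_inf_left _ inf_le_right) x.2.le
    rw [h4, finrank_bot] at h3
    exact h3
  have hle : vdim h x ≤ finrank F Y := Submodule.finrank_mono hxY
  rw [hcard, hdim] at htot
  have hpos : 0 < q ^ vdim h x := pow_pos (by omega) _
  refine Nat.eq_of_mul_eq_mul_left hpos ?_
  rw [← pow_add, Nat.add_sub_cancel' hle, ← htot, pow_add]
  ring

/-- The vertex given by a subspace of a vertex. -/
def AttX.ofLE {h : Submodule F H} (x : AttX h) (v : Submodule F H) (hv : v ≤ x.1) : AttX h :=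
  ⟨v, eq_bot_iff.2 ((inf_le_inf_right h hv).trans x.2.le)⟩

theorem vdim_add_vdim {h : Submodule F H} (x z : AttX h) :
    vdim h x + vdim h z
      = finrank F (x.1 ⊔ z.1 : Submodule F H) + finrank F (x.1 ⊓ z.1 : Submodule F H) :=
  (Submodule.finrank_sup_add_finrank_inf_eq x.1 z.1).symm

theorem AttX.eq_of_le {h : Submodule F H} {x y : AttX h} (hxy : x.1 ≤ y.1)
    (hd : vdim h y ≤ vdim h x) : x = y :=
  Subtype.ext (Submodule.eq_of_le_of_finrank_le hxy hd)

theorem finrank_inf_lt_vdim {h : Submodule F H} {x : AttX h} {Y : Submodule F H}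
    (hxY : ¬ x.1 ≤ Y) : finrank F (x.1 ⊓ Y : Submodule F H) < vdim h x :=
  Submodule.finrank_lt_finrank_of_lt (inf_lt_left.2 hxY)

/-- Distinct vertices covered by a common vertex meet in codimension one. -/
theorem finrank_inf_add_one {h : Submodule F H} {w x z : AttX h} (hw : AttCovers h w z)
    (hx : AttCovers h x z) (hne : w ≠ x) :
    finrank F (w.1 ⊓ x.1 : Submodule F H) + 1 = vdim h x := by
  have h1 := vdim_add_vdim w x
  have h2 : finrank F (w.1 ⊔ x.1 : Submodule F H) ≤ vdim h z :=
    Submodule.finrank_mono (sup_le hw.1 hx.1)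
  have h3 := hw.2
  have h4 := hx.2
  have h5 : finrank F (w.1 ⊓ x.1 : Submodule F H) < vdim h w :=
    finrank_inf_lt_vdim fun hle => hne (AttX.eq_of_le hle (by omega))
  omega

/-- If `y, z` cover `x` and are distinct then `x` is the only vertex they both cover. -/
theorem eq_of_attCovers_of_attCovers {h : Submodule F H} {w x y z : AttX h} (hne : y ≠ z)
    (hxy : AttCovers h x y) (hxz : AttCovers h x z) (hwy : AttCovers h w y)
    (hwz : AttCovers h w z) : w = x := by
  by_contra hwx
  have h1 := vdim_add_vdim w x
  have h2 := finrank_inf_add_one hwy hxy hwx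
  have h3 := hwy.2
  have h4 := hxy.2
  have h5 := hxz.2
  have h6 : finrank F (w.1 ⊔ x.1 : Submodule F H) = vdim h y := by omega
  have h7 : w.1 ⊔ x.1 = y.1 :=
    Submodule.eq_of_le_of_finrank_eq (sup_le hwy.1 hxy.1) h6
  have h8 : w.1 ⊔ x.1 = z.1 :=
    Submodule.eq_of_le_of_finrank_eq (sup_le hwz.1 hxz.1) (by rw [h6]; exact (by omega : vdim h y = vdim h z))
  exact hne (Subtype.ext (h7.symm.trans h8))

/-- An interval of length two has `q + 1` intermediate vertices. -/
theorem card_attCovers_le_of_vdim {h : Submodule F H} {x y : AttX h} (hxy : x.1 ≤ y.1)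
    (hd : vdim h y = vdim h x + 2) :
    #{w : AttX h | AttCovers h x w ∧ w.1 ≤ y.1} = Fintype.card F + 1 := by
  have hc := card_attCovers_le x hxy
  have hdim : finrank F y.1 - vdim h x = 2 := by
    have : finrank F y.1 = vdim h x + 2 := hd
    omega
  have hbot : finrank F (y.1 ⊓ h : Submodule F H) = 0 := by
    rw [Submodule.finrank_eq_zero]
    exact y.2
  rw [hbot, hdim] at hc
  have hq : 1 < Fintype.card F := Fintype.one_lt_card
  obtain ⟨r, hr⟩ : ∃ r, Fintype.card F = r + 1 := ⟨Fintype.card F - 1, by omega⟩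
  rw [hr] at hc ⊢
  have hr' : 0 < r := by omega
  refine Nat.eq_of_mul_eq_mul_right hr' ?_
  simp only [Nat.add_sub_cancel, pow_zero] at hc
  nlinarith

/-- Counting the vertices covered by `z` through those covered by one of them. -/
theorem card_attCovers_eq {h : Submodule F H} {x z : AttX h} (hxz : AttCovers h x z) :
    #{w : AttX h | AttCovers h w z}
      = 1 + Fintype.card F * #{v : AttX h | AttCovers h v x} := by
  have hmem : x ∈ ({w : AttX h | AttCovers h w z} : Finset (AttX h)) := by simpa using hxz
  rw [← Finset.card_erase_add_one hmem, add_comm]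
  congr 1
  rw [Finset.card_eq_sum_card_fiberwise (f := fun w => x.ofLE (w.1 ⊓ x.1) inf_le_right)
    (t := {v : AttX h | AttCovers h v x})]
  · rw [Finset.sum_const_nat (m := Fintype.card F), mul_comm]
    intro v hv
    simp only [mem_filter, mem_univ, true_and] at hv
    have hvz : vdim h z = vdim h v + 2 := by
      have := hv.2
      have := hxz.2
      omega
    have hcard := card_attCovers_le_of_vdim (hv.1.trans hxz.1) hvz
    have hxmem : x ∈ ({w : AttX h | AttCovers h v w ∧ w.1 ≤ z.1} : Finset (AttX h)) := by
      simpa using ⟨hv, hxz.1⟩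
    rw [← Finset.card_erase_add_one hxmem, Nat.add_right_cancel_iff] at hcard
    rw [← hcard]
    congr 1
    ext w
    simp only [mem_filter, mem_erase, mem_univ, true_and]
    constructor
    · rintro ⟨⟨hne, hw⟩, rfl⟩
      refine ⟨hne, ⟨inf_le_left, ?_⟩, hw.1⟩
      have h1 : vdim h (x.ofLE (w.1 ⊓ x.1) inf_le_right) + 1 = vdim h x :=
        finrank_inf_add_one hw hxz hne
      have := hw.2
      have := hxz.2
      omega
    · rintro ⟨hne, hvw, hwz⟩
      have hw : AttCovers h w z := ⟨hwz, by have := hvw.2; omega⟩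
      refine ⟨⟨hne, hw⟩, ?_⟩
      refine (AttX.eq_of_le (le_inf hvw.1 hv.1) ?_).symm
      have h1 : vdim h (x.ofLE (w.1 ⊓ x.1) inf_le_right) + 1 = vdim h x :=
        finrank_inf_add_one hw hxz hne
      have := hv.2
      omega
  · intro w hw
    simp only [coe_erase, coe_filter, mem_univ, true_and, Set.mem_sdiff, Set.mem_ofPred_eq,
      Set.mem_singleton_iff] at hw ⊢
    exact ⟨inf_le_right, (finrank_inf_add_one hw.1 hxz hw.2).symm⟩

theorem card_attCovers {h : Submodule F H} (x : AttX h) :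
    #{y : AttX h | AttCovers h x y} * (Fintype.card F - 1) + Fintype.card F ^ finrank F h
      = Fintype.card F ^ (finrank F H - vdim h x) := by
  have := card_attCovers_le x (Y := ⊤) le_top
  rw [top_inf_eq, finrank_top] at this
  simpa using this

theorem card_zigzag_of_attCovers {h : Submodule F H} {x z : AttX h} (hxz : AttCovers h x z) :
    #{y : AttX h | AttCovers h z y} + Fintype.card F * #{v : AttX h | AttCovers h v x}
        + Fintype.card F ^ (finrank F H - vdim h z)
      = ∑ y : AttX h with AttCovers h x y, #{w : AttX h | AttCovers h w y ∧ AttCovers h w z} := by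
  have hmem : z ∈ ({y : AttX h | AttCovers h x y} : Finset (AttX h)) := by simpa using hxz
  rw [← Finset.add_sum_erase _ _ hmem]
  have hone : ∀ y ∈ ({y : AttX h | AttCovers h x y} : Finset (AttX h)).erase z,
      #{w : AttX h | AttCovers h w y ∧ AttCovers h w z} = 1 := by
    intro y hy
    simp only [mem_erase, mem_filter, mem_univ, true_and] at hy
    rw [Finset.card_eq_one]
    refine ⟨x, ?_⟩
    ext w
    simp only [mem_filter, mem_univ, true_and, mem_singleton]
    constructor
    · rintro ⟨h1, h2⟩
      exact eq_of_attCovers_of_attCovers hy.1 hy.2 hxz h1 h2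
    · rintro rfl
      exact ⟨hy.2, hxz⟩
  rw [Finset.sum_congr rfl hone]
  simp only [and_self, sum_const, smul_eq_mul, mul_one]
  rw [card_attCovers_eq hxz]
  have hx := card_attCovers x
  have hz := card_attCovers z
  have hcard := Finset.card_erase_add_one hmem
  have hzH : vdim h z ≤ finrank F H := Submodule.finrank_le _
  have hsub : finrank F H - vdim h x = finrank F H - vdim h z + 1 := by
    have := hxz.2
    omega
  rw [hsub, pow_succ] at hx
  have hq : 1 < Fintype.card F := Fintype.one_lt_card
  obtain ⟨r, hr⟩ : ∃ r, Fintype.card F = r + 1 := ⟨Fintype.card F - 1, by omega⟩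
  have hr' : 0 < r := by omega
  have key : #{y : AttX h | AttCovers h x y}
      = #{y : AttX h | AttCovers h z y} + Fintype.card F ^ (finrank F H - vdim h z) := by
    refine Nat.eq_of_mul_eq_mul_right hr' ?_
    simp only [hr, Nat.add_sub_cancel] at hx hz ⊢
    nlinarith
  omega

theorem card_zigzag_of_not_le {h : Submodule F H} {x z : AttX h} (hxz : ¬ x.1 ≤ z.1)
    (hd : vdim h z = vdim h x + 1) :
    #{y : AttX h | AttCovers h z y ∧ x.1 ≤ y.1}
        + Fintype.card F * #{v : AttX h | AttCovers h v x ∧ v.1 ≤ z.1}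
      = ∑ y : AttX h with AttCovers h x y, #{w : AttX h | AttCovers h w y ∧ AttCovers h w z} := by
  have hlt := finrank_inf_lt_vdim hxz
  have hadd := vdim_add_vdim x z
  have hmid : ∀ y w, AttCovers h x y → AttCovers h w y → AttCovers h w z →
      vdim h x ≤ finrank F (x.1 ⊓ z.1 : Submodule F H) + 1 := by
    intro y w hxy hwy hwz
    have hwx : w ≠ x := by
      rintro rfl
      exact hxz hwz.1
    rw [← finrank_inf_add_one hwy hxy hwx]
    gcongr
    exact Submodule.finrank_mono (le_inf inf_le_right (inf_le_left.trans hwz.1))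
  by_cases hI : finrank F (x.1 ⊓ z.1 : Submodule F H) + 1 = vdim h x
  · have hsup : finrank F (x.1 ⊔ z.1 : Submodule F H) = vdim h x + 2 := by omega
    have hP : ({y : AttX h | AttCovers h z y ∧ x.1 ≤ y.1} : Finset (AttX h))
        = ({y : AttX h | AttCovers h z y ∧ y.1 ≤ x.1 ⊔ z.1} : Finset (AttX h)) := by
      ext y
      simp only [mem_filter, mem_univ, true_and, and_congr_right_iff]
      intro hzy
      have hy : finrank F y.1 = finrank F (x.1 ⊔ z.1 : Submodule F H) := by
        have h1 : finrank F y.1 = vdim h z + 1 := hzy.2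
        omega
      constructor
      · intro hxy
        exact (Submodule.eq_of_le_of_finrank_eq (sup_le hxy hzy.1) hy.symm).ge
      · intro hle
        exact le_sup_left.trans (Submodule.eq_of_le_of_finrank_eq hle hy).ge
    have hQ : #{v : AttX h | AttCovers h v x ∧ v.1 ≤ z.1} = 1 := by
      rw [Finset.card_eq_one]
      refine ⟨x.ofLE (x.1 ⊓ z.1) inf_le_left, ?_⟩
      ext v
      simp only [mem_filter, mem_univ, true_and, mem_singleton]
      constructor
      · rintro ⟨hvx, hvz⟩
        refine AttX.eq_of_le (le_inf hvx.1 hvz) ?_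
        have h1 : vdim h (x.ofLE (x.1 ⊓ z.1) inf_le_left) + 1 = vdim h x := hI
        have := hvx.2
        omega
      · rintro rfl
        exact ⟨⟨inf_le_left, hI.symm⟩, inf_le_right⟩
    have hfib : ∀ y ∈ ({y : AttX h | AttCovers h x y} : Finset (AttX h)),
        #{w : AttX h | AttCovers h w y ∧ AttCovers h w z}
          = if y.1 ≤ x.1 ⊔ z.1 then 1 else 0 := by
      intro y hy
      simp only [mem_filter, mem_univ, true_and] at hy
      have hyz : ¬ y.1 ≤ z.1 := fun hle => hxz (hy.1.trans hle)
      have hlt' := finrank_inf_lt_vdim hyz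
      have hadd' := vdim_add_vdim y z
      have hle' : x.1 ⊔ z.1 ≤ y.1 ⊔ z.1 := sup_le_sup_right hy.1 _
      have hdy := hy.2
      split_ifs with hys
      · have hyz' : finrank F (y.1 ⊔ z.1 : Submodule F H) = vdim h x + 2 := by
          rw [← hsup, le_antisymm (sup_le hys le_sup_right) hle']
        have hinf : finrank F (y.1 ⊓ z.1 : Submodule F H) = vdim h x := by omega
        rw [Finset.card_eq_one]
        refine ⟨y.ofLE (y.1 ⊓ z.1) inf_le_left, ?_⟩
        ext w
        simp only [mem_filter, mem_univ, true_and, mem_singleton]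
        constructor
        · rintro ⟨hwy, hwz⟩
          refine AttX.eq_of_le (le_inf hwy.1 hwz.1) ?_
          have h1 : vdim h (y.ofLE (y.1 ⊓ z.1) inf_le_left) = vdim h x := hinf
          have := hwy.2
          omega
        · rintro rfl
          have h1 : vdim h (y.ofLE (y.1 ⊓ z.1) inf_le_left) = vdim h x := hinf
          exact ⟨⟨inf_le_left, by omega⟩, inf_le_right, by omega⟩
      · rw [Finset.card_eq_zero, Finset.filter_eq_empty_iff]
        rintro w - ⟨hwy, hwz⟩
        have h1 : vdim h w ≤ finrank F (y.1 ⊓ z.1 : Submodule F H) :=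
          Submodule.finrank_mono (le_inf hwy.1 hwz.1)
        have h2 := hwy.2
        have h3 : x.1 ⊔ z.1 = y.1 ⊔ z.1 :=
          Submodule.eq_of_le_of_finrank_le hle' (by omega)
        exact hys (h3 ▸ le_sup_left)
    rw [Finset.sum_congr rfl hfib, Finset.sum_boole, Finset.filter_filter, hP, hQ, Nat.cast_id]
    have hx := card_attCovers_le x (Y := x.1 ⊔ z.1) le_sup_left
    have hz := card_attCovers_le z (Y := x.1 ⊔ z.1) le_sup_right
    rw [hsup, Nat.add_sub_cancel_left] at hx
    rw [hsup, hd, show vdim h x + 2 - (vdim h x + 1) = 1 by omega] at hz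
    have hq : 1 < Fintype.card F := Fintype.one_lt_card
    obtain ⟨r, hr⟩ : ∃ r, Fintype.card F = r + 1 := ⟨Fintype.card F - 1, by omega⟩
    have hr' : 0 < r := by omega
    refine Nat.eq_of_mul_eq_mul_right hr' ?_
    simp only [hr, Nat.add_sub_cancel] at hx hz ⊢
    nlinarith
  · have hP : #{y : AttX h | AttCovers h z y ∧ x.1 ≤ y.1} = 0 := by
      rw [Finset.card_eq_zero, Finset.filter_eq_empty_iff]
      rintro y - ⟨hzy, hxy⟩
      have h1 : finrank F (x.1 ⊔ z.1 : Submodule F H) ≤ vdim h y :=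
        Submodule.finrank_mono (sup_le hxy hzy.1)
      have := hzy.2
      omega
    have hQ : #{v : AttX h | AttCovers h v x ∧ v.1 ≤ z.1} = 0 := by
      rw [Finset.card_eq_zero, Finset.filter_eq_empty_iff]
      rintro v - ⟨hvx, hvz⟩
      have h1 : vdim h v ≤ finrank F (x.1 ⊓ z.1 : Submodule F H) :=
        Submodule.finrank_mono (le_inf hvx.1 hvz)
      have := hvx.2
      omega
    rw [hP, hQ, eq_comm, zero_add, mul_zero, Finset.sum_eq_zero_iff]
    intro y hy
    simp only [mem_filter, mem_univ, true_and] at hy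
    rw [Finset.card_eq_zero, Finset.filter_eq_empty_iff]
    rintro w - ⟨hwy, hwz⟩
    have := hmid y w hy hwy hwz
    omega

theorem Amat_eq (h : Submodule F H) (q : ℕ) : Amat h q = Rmat h + Lmat h q := by
  ext y z
  simp only [Amat, Rmat, Lmat, Matrix.add_apply]
  by_cases h₁ : AttCovers h z y <;> by_cases h₂ : AttCovers h y z <;> simp [h₁, h₂]
  have := h₁.2
  have := h₂.2
  omega

theorem Rmat_mul_Astar (h : Submodule F H) {q : ℕ} (hq : q ≠ 0) :
    Rmat h * Astar h q = (q : ℂ) • (Astar h q * Rmat h) := by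
  have hq' : (q : ℂ) ≠ 0 := by exact_mod_cast hq
  ext y z
  simp only [Astar, mul_diagonal, Matrix.smul_apply, diagonal_mul, Rmat, smul_eq_mul]
  split_ifs with hc
  · rw [hc.2]
    push_cast
    rw [neg_add, zpow_add₀ hq']
    field_simp
  · simp

theorem Lmat_mul_Astar (h : Submodule F H) {q : ℕ} (hq : q ≠ 0) :
    Lmat h q * Astar h q = (q : ℂ)⁻¹ • (Astar h q * Lmat h q) := by
  have hq' : (q : ℂ) ≠ 0 := by exact_mod_cast hq
  ext y z
  simp only [Astar, mul_diagonal, Matrix.smul_apply, diagonal_mul, Lmat, smul_eq_mul]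
  split_ifs with hc
  · rw [hc.2]
    push_cast
    rw [neg_add, zpow_add₀ hq']
    field_simp
  · simp

theorem transpose_Lpmat (h : Submodule F H) : (Lpmat h)ᵀ = Rmat h := rfl

theorem transpose_Rmat (h : Submodule F H) : (Rmat h)ᵀ = Lpmat h := rfl

/-- The diagonal matrix with `(y,y)`-entry `q^(dim y)`. -/
def Dmat (h : Submodule F H) (q : ℕ) : Matrix (AttX h) (AttX h) ℂ :=
  Matrix.diagonal fun y => (q : ℂ) ^ vdim h y

theorem Dmat_mul_Lpmat (h : Submodule F H) (q : ℕ) : Dmat h q * Lpmat h = Lmat h q := by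
  ext y z
  simp [Dmat, Lpmat, Lmat, diagonal_mul]

theorem Lpmat_mul_Dmat (h : Submodule F H) (q : ℕ) :
    Lpmat h * Dmat h q = (q : ℂ) • (Dmat h q * Lpmat h) := by
  ext y z
  simp only [Dmat, mul_diagonal, Matrix.smul_apply, diagonal_mul, Lpmat, smul_eq_mul]
  split_ifs with hc
  · rw [hc.2]
    ring
  · simp

theorem Rmat_mul_Dmat (h : Submodule F H) {q : ℕ} (hq : q ≠ 0) :
    Rmat h * Dmat h q = (q : ℂ)⁻¹ • (Dmat h q * Rmat h) := by
  have hq' : (q : ℂ) ≠ 0 := by exact_mod_cast hq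
  ext y z
  simp only [Dmat, mul_diagonal, Matrix.smul_apply, diagonal_mul, Rmat, smul_eq_mul]
  split_ifs with hc
  · rw [hc.2]
    field_simp
    ring
  · simp

theorem Lpmat_mul_Lpmat_apply {h : Submodule F H} {q : ℕ} (hq : Fintype.card F = q)
    (x y : AttX h) : (Lpmat h * Lpmat h) x y
      = if x.1 ≤ y.1 ∧ vdim h y = vdim h x + 2 then (q : ℂ) + 1 else 0 := by
  simp only [mul_apply, Lpmat, mul_ite, mul_one, mul_zero, ← ite_and]
  rw [Finset.sum_boole]
  split_ifs with hxy
  · have hset : ({w : AttX h | AttCovers h w y ∧ AttCovers h x w} : Finset (AttX h))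
        = ({w : AttX h | AttCovers h x w ∧ w.1 ≤ y.1} : Finset (AttX h)) := by
      ext w
      simp only [mem_filter, mem_univ, true_and]
      constructor
      · rintro ⟨h1, h2⟩
        exact ⟨h2, h1.1⟩
      · rintro ⟨h1, h2⟩
        refine ⟨⟨h2, ?_⟩, h1⟩
        have := h1.2
        omega
    rw [hset, card_attCovers_le_of_vdim hxy.1 hxy.2, hq]
    push_cast
    rfl
  · rw [Nat.cast_eq_zero, Finset.card_eq_zero, Finset.filter_eq_empty_iff]
    rintro w - ⟨h1, h2⟩
    refine hxy ⟨h2.1.trans h1.1, ?_⟩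
    have := h1.2
    have := h2.2
    omega

theorem Lpmat_mul_Lpmat_mul_Rmat_apply {h : Submodule F H} {q : ℕ} (hq : Fintype.card F = q)
    (x z : AttX h) : (Lpmat h * Lpmat h * Rmat h) x z
      = ((q : ℂ) + 1)
        * #{y : AttX h | AttCovers h z y ∧ x.1 ≤ y.1 ∧ vdim h y = vdim h x + 2} := by
  rw [mul_apply]
  simp only [Lpmat_mul_Lpmat_apply hq, Rmat, mul_ite, mul_one, mul_zero, ← ite_and]
  rw [← Finset.sum_filter, Finset.sum_const, nsmul_eq_mul, mul_comm]

theorem Rmat_mul_Lpmat_mul_Lpmat_apply {h : Submodule F H} {q : ℕ} (hq : Fintype.card F = q)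
    (x z : AttX h) : (Rmat h * (Lpmat h * Lpmat h)) x z
      = ((q : ℂ) + 1)
        * #{v : AttX h | AttCovers h v x ∧ v.1 ≤ z.1 ∧ vdim h z = vdim h v + 2} := by
  rw [mul_apply]
  simp only [Lpmat_mul_Lpmat_apply hq, Rmat, ite_mul, one_mul, zero_mul, ← ite_and]
  rw [← Finset.sum_filter, Finset.sum_const, nsmul_eq_mul, mul_comm]

theorem Lpmat_mul_Rmat_mul_Lpmat_apply (h : Submodule F H) (x z : AttX h) :
    (Lpmat h * (Rmat h * Lpmat h)) x z
      = ∑ y : AttX h with AttCovers h x y,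
        (#{w : AttX h | AttCovers h w y ∧ AttCovers h w z} : ℂ) := by
  simp only [mul_apply, Lpmat, Rmat, ite_mul, one_mul, zero_mul, ← ite_and, Finset.sum_boole]
  rw [Finset.sum_filter]

/-- The cubic relation between the raising and lowering matrices of the uniform poset. -/
theorem Dmat_mul_lowering_relation (h : Submodule F H) {q : ℕ} (hq : Fintype.card F = q) :
    (q : ℂ) • (Dmat h q * (Lpmat h * Lpmat h * Rmat h
        - ((q : ℂ) + 1) • (Lpmat h * (Rmat h * Lpmat h))
        + (q : ℂ) • (Rmat h * (Lpmat h * Lpmat h))))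
      = -((((q : ℂ) + 1) * (q : ℂ) ^ finrank F H) • Lpmat h) := by
  ext x z
  simp only [Matrix.smul_apply, Matrix.neg_apply, Dmat, diagonal_mul, Matrix.add_apply,
    Matrix.sub_apply, smul_eq_mul, Lpmat_mul_Lpmat_mul_Rmat_apply hq,
    Rmat_mul_Lpmat_mul_Lpmat_apply hq, Lpmat_mul_Rmat_mul_Lpmat_apply]
  by_cases hd : vdim h z = vdim h x + 1
  · have hP : ({y : AttX h | AttCovers h z y ∧ x.1 ≤ y.1 ∧ vdim h y = vdim h x + 2}
        : Finset (AttX h)) = ({y : AttX h | AttCovers h z y ∧ x.1 ≤ y.1} : Finset (AttX h)) := by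
      refine Finset.filter_congr fun y _ => ?_
      refine and_congr_right fun hy => and_iff_left ?_
      have := hy.2
      omega
    have hQ : ({v : AttX h | AttCovers h v x ∧ v.1 ≤ z.1 ∧ vdim h z = vdim h v + 2}
        : Finset (AttX h)) = ({v : AttX h | AttCovers h v x ∧ v.1 ≤ z.1} : Finset (AttX h)) := by
      refine Finset.filter_congr fun v _ => ?_
      refine and_congr_right fun hv => and_iff_left ?_
      have := hv.2
      omega
    rw [hP, hQ]
    by_cases hxz : x.1 ≤ z.1
    · have hP' : ({y : AttX h | AttCovers h z y ∧ x.1 ≤ y.1} : Finset (AttX h))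
          = ({y : AttX h | AttCovers h z y} : Finset (AttX h)) :=
        Finset.filter_congr fun y _ => and_iff_left_of_imp fun hy => hxz.trans hy.1
      have hQ' : ({v : AttX h | AttCovers h v x ∧ v.1 ≤ z.1} : Finset (AttX h))
          = ({v : AttX h | AttCovers h v x} : Finset (AttX h)) :=
        Finset.filter_congr fun v _ => and_iff_left_of_imp fun hv => hv.1.trans hxz
      have key := congrArg (Nat.cast : ℕ → ℂ) (card_zigzag_of_attCovers ⟨hxz, hd⟩)
      have hzH : vdim h z ≤ finrank F H := Submodule.finrank_le _
      have hpow : (q : ℂ) ^ finrank F H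
          = q * q ^ vdim h x * q ^ (finrank F H - vdim h z) := by
        rw [← pow_succ', ← pow_add]
        congr 1
        omega
      rw [hq] at key
      push_cast at key
      rw [hP', hQ', ← key, hpow, Lpmat, if_pos ⟨hxz, hd⟩]
      ring
    · have key := congrArg (Nat.cast : ℕ → ℂ) (card_zigzag_of_not_le hxz hd)
      rw [hq] at key
      push_cast at key
      rw [← key, Lpmat, if_neg fun hc => hxz hc.1]
      ring
  · have hP : ({y : AttX h | AttCovers h z y ∧ x.1 ≤ y.1 ∧ vdim h y = vdim h x + 2}
        : Finset (AttX h)) = ∅ := by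
      refine Finset.filter_eq_empty_iff.2 fun y _ hy => hd ?_
      have := hy.1.2
      have := hy.2.2
      omega
    have hQ : ({v : AttX h | AttCovers h v x ∧ v.1 ≤ z.1 ∧ vdim h z = vdim h v + 2}
        : Finset (AttX h)) = ∅ := by
      refine Finset.filter_eq_empty_iff.2 fun v _ hv => hd ?_
      have := hv.1.2
      have := hv.2.2
      omega
    have hT : ∑ y : AttX h with AttCovers h x y,
        (#{w : AttX h | AttCovers h w y ∧ AttCovers h w z} : ℂ) = 0 := by
      refine Finset.sum_eq_zero fun y hy => ?_
      rw [Nat.cast_eq_zero, Finset.card_eq_zero]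
      refine Finset.filter_eq_empty_iff.2 fun w _ hw => hd ?_
      have := (mem_filter.1 hy).2.2
      have := hw.1.2
      have := hw.2.2
      omega
    rw [hP, hQ, hT, Lpmat, if_neg fun hc => hd hc.2]
    simp

theorem raising_relation_mul_Dmat (h : Submodule F H) {q : ℕ} (hq : Fintype.card F = q) :
    (q : ℂ) • ((Lpmat h * (Rmat h * Rmat h) - ((q : ℂ) + 1) • (Rmat h * Lpmat h * Rmat h)
        + (q : ℂ) • (Rmat h * Rmat h * Lpmat h)) * Dmat h q)
      = -((((q : ℂ) + 1) * (q : ℂ) ^ finrank F H) • Rmat h) := by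
  have := congrArg transpose (Dmat_mul_lowering_relation h hq)
  have hD : (Dmat h q)ᵀ = Dmat h q := diagonal_transpose _
  simpa only [transpose_smul, transpose_mul, transpose_add, transpose_sub, transpose_neg, hD,
    transpose_Lpmat, transpose_Rmat] using this

theorem lowering_relation_of_diagonal {𝓐 : Type*} [Ring 𝓐] [Algebra ℂ 𝓐] {D R L' : 𝓐} {q c : ℂ}
    (hq : q ≠ 0) (hRD : R * D = q⁻¹ • (D * R)) (hLD : L' * D = q • (D * L'))
    (hrel : q • (D * (L' * L' * R - (q + 1) • (L' * (R * L')) + q • (R * (L' * L')))) = -(c • L')) :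
    D * L' * (D * L' * R) = (q * (q + 1)) • (D * L' * (R * (D * L')))
      - q ^ 3 • (R * (D * L' * (D * L'))) - c • (D * L') := by
  have hRD' : ∀ X, R * (D * X) = q⁻¹ • (D * (R * X)) := fun X => by
    rw [← mul_assoc, hRD, smul_mul_assoc, mul_assoc]
  have hLD' : ∀ X, L' * (D * X) = q • (D * (L' * X)) := fun X => by
    rw [← mul_assoc, hLD, smul_mul_assoc, mul_assoc]
  have hrel' := congrArg (D * ·) hrel
  simp only [mul_add, mul_sub, mul_neg, mul_smul_comm, mul_assoc, smul_add,
    smul_sub] at hrel'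
  simp only [mul_assoc, hRD', hLD', mul_smul_comm]
  rw [← sub_eq_zero] at hrel' ⊢
  refine Eq.trans ?_ hrel'
  match_scalars <;> field_simp

theorem raising_relation_of_diagonal {𝓐 : Type*} [Ring 𝓐] [Algebra ℂ 𝓐] {D R L' : 𝓐} {q c : ℂ}
    (hq : q ≠ 0) (hRD : R * D = q⁻¹ • (D * R)) (hLD : L' * D = q • (D * L'))
    (hrel : q • ((L' * (R * R) - (q + 1) • (R * L' * R) + q • (R * R * L')) * D) = -(c • R)) :
    D * L' * (R * R) = (q * (q + 1)) • (R * (D * L' * R))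
      - q ^ 3 • (R * (R * (D * L'))) - c • R := by
  have hRD' : ∀ X, R * (D * X) = q⁻¹ • (D * (R * X)) := fun X => by
    rw [← mul_assoc, hRD, smul_mul_assoc, mul_assoc]
  have hLD' : ∀ X, L' * (D * X) = q • (D * (L' * X)) := fun X => by
    rw [← mul_assoc, hLD, smul_mul_assoc, mul_assoc]
  simp only [add_mul, sub_mul, mul_smul_comm, smul_mul_assoc, mul_assoc, smul_add,
    smul_sub, hRD, hLD, hRD', hLD'] at hrel
  simp only [mul_assoc, hRD', mul_smul_comm]
  rw [← sub_eq_zero] at hrel ⊢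
  refine Eq.trans ?_ hrel
  match_scalars <;> field_simp

theorem theta_eq (q N M k : ℕ) (hq : 1 < q) (hk : k ≤ 2 * N) :
    theta q N M k = Real.sqrt q ^ M / ((q : ℝ) - 1)
      * (Real.sqrt q ^ (2 * N) / Real.sqrt q ^ k - Real.sqrt q ^ k) := by
  have hs : Real.sqrt q ≠ 0 := by positivity
  rw [theta, pow_sub₀ _ hs hk]
  ring

theorem sub_ne_zero_of_shifted {c Q a b : ℝ} (hc : 0 < c) (hQ : 0 < Q) (ha : 0 < a) (hb : 0 < b)
    (hab : a ≠ b) : c * (Q / a - a) - c * (Q / b - b) ≠ 0 := by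
  have : c * (Q / a - a) - c * (Q / b - b) = c * (b - a) * (1 + Q / (a * b)) := by
    field_simp
    ring
  rw [this]
  have : b - a ≠ 0 := sub_ne_zero.2 hab.symm
  have : 1 + Q / (a * b) ≠ 0 := by positivity
  have := hc.ne'
  simp_all

theorem quadratic_ne_zero_of_shifted {c Q q a b : ℝ} (hc : 0 < c) (hQ : 0 < Q) (hq : 0 < q)
    (ha : 0 < a) (hb : 0 < b) (h₁ : b ≠ a * q) (h₂ : a ≠ b * q) :
    (c * (Q / a - a)) ^ 2 - (q + q⁻¹) * (c * (Q / a - a)) * (c * (Q / b - b))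
      + (c * (Q / b - b)) ^ 2 - c ^ 2 * Q * (q - q⁻¹) ^ 2 ≠ 0 := by
  have : (c * (Q / a - a)) ^ 2 - (q + q⁻¹) * (c * (Q / a - a)) * (c * (Q / b - b))
      + (c * (Q / b - b)) ^ 2 - c ^ 2 * Q * (q - q⁻¹) ^ 2
      = c ^ 2 * (b - a * q) * (b * q - a) * (b + Q / (a * q)) * (b + Q * q / a)
        / (q * b ^ 2) := by
    field_simp
    ring
  rw [this]
  have h3 : b - a * q ≠ 0 := sub_ne_zero.2 h₁
  have h4 : b * q - a ≠ 0 := sub_ne_zero.2 h₂.symm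
  have h5 : b + Q / (a * q) ≠ 0 := by positivity
  have h6 : b + Q * q / a ≠ 0 := by positivity
  have := hc.ne'
  have := hq.ne'
  have := hb.ne'
  simp_all

theorem theta_sub_ne_zero {q N M k l : ℕ} (hq : 1 < q) (hk : k ≤ 2 * N) (hl : l ≤ 2 * N)
    (hkl : k ≠ l) : theta q N M k - theta q N M l ≠ 0 := by
  have hs : 1 < Real.sqrt q := Real.lt_sqrt_of_sq_lt (by simpa using hq)
  have hq1 : (0 : ℝ) < (q : ℝ) - 1 := by simpa using hq
  rw [theta_eq q N M k hq hk, theta_eq q N M l hq hl]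
  refine sub_ne_zero_of_shifted (by positivity) (by positivity) (by positivity) (by positivity) ?_
  exact fun h => hkl (pow_right_injective₀ (by positivity) hs.ne' h)

theorem theta_quadratic_ne_zero {q N M k l : ℕ} (hq : 1 < q) (hk : k ≤ 2 * N) (hl : l ≤ 2 * N)
    (h₁ : k ≠ l + 2) (h₂ : l ≠ k + 2) :
    theta q N M k ^ 2 - (q + (q : ℝ)⁻¹) * theta q N M k * theta q N M l + theta q N M l ^ 2
      - (q : ℝ) ^ (N + M) * (1 + (q : ℝ)⁻¹) ^ 2 ≠ 0 := by
  have hs : 1 < Real.sqrt q := Real.lt_sqrt_of_sq_lt (by simpa using hq)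
  have hq1 : (0 : ℝ) < (q : ℝ) - 1 := by simpa using hq
  have hsq : Real.sqrt q ^ 2 = q := Real.sq_sqrt (by positivity)
  have hinj := pow_right_injective₀ (zero_lt_one.trans hs) hs.ne'
  have hγ : (q : ℝ) ^ (N + M) * (1 + (q : ℝ)⁻¹) ^ 2
      = (Real.sqrt q ^ M / ((q : ℝ) - 1)) ^ 2 * Real.sqrt q ^ (2 * N)
        * ((q : ℝ) - (q : ℝ)⁻¹) ^ 2 := by
    have : (q : ℝ) ≠ 0 := by positivity
    rw [div_pow, ← pow_mul, mul_comm M 2, pow_mul, pow_mul, hsq]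
    field_simp
    ring
  rw [hγ, theta_eq q N M k hq hk, theta_eq q N M l hq hl]
  refine quadratic_ne_zero_of_shifted (by positivity) (by positivity) (by positivity)
    (by positivity) (by positivity) ?_ ?_
  · intro h
    refine h₂ (hinj ?_)
    simp only [pow_add, hsq]
    exact h
  · intro h
    refine h₁ (hinj ?_)
    simp only [pow_add, hsq]
    exact h

theorem tridiagonal_of_raising_lowering {𝓐 : Type*} [Ring 𝓐] [Algebra ℂ 𝓐] {K R L : 𝓐} {q c : ℂ}
    (hq : q ≠ 0) (hRK : R * K = q • (K * R)) (hLK : L * K = q⁻¹ • (K * L))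
    (hLLR : L * (L * R)
      = (q * (q + 1)) • (L * (R * L)) - q ^ 3 • (R * (L * L)) - ((q + 1) * c) • L)
    (hLRR : L * (R * R)
      = (q * (q + 1)) • (R * (L * R)) - q ^ 3 • (R * (R * L)) - ((q + 1) * c) • R) :
    (R + L) * (R + L) * (R + L) * K - (q + q⁻¹ + 1) • ((R + L) * (R + L) * K * (R + L))
      + (q + q⁻¹ + 1) • ((R + L) * K * (R + L) * (R + L)) - K * (R + L) * (R + L) * (R + L)
      = (c * (1 + q⁻¹) ^ 2) • ((R + L) * K - K * (R + L)) := by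
  have hRK' : ∀ X, R * (K * X) = q • (K * (R * X)) := fun X => by
    rw [← mul_assoc, hRK, smul_mul_assoc, mul_assoc]
  have hLK' : ∀ X, L * (K * X) = q⁻¹ • (K * (L * X)) := fun X => by
    rw [← mul_assoc, hLK, smul_mul_assoc, mul_assoc]
  simp only [mul_add, add_mul, mul_assoc, hRK, hRK', hLK, hLK', mul_smul_comm, smul_mul_assoc]
  simp only [hLLR, hLRR, mul_sub, mul_smul_comm]
  match_scalars <;> field_simp <;> ring

theorem Amat_Astar_tridiagonal (h : Submodule F H) {q : ℕ} (hq : Fintype.card F = q) :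
    Amat h q * Amat h q * Amat h q * Astar h q
      - ((q : ℂ) + (q : ℂ)⁻¹ + 1) • (Amat h q * Amat h q * Astar h q * Amat h q)
      + ((q : ℂ) + (q : ℂ)⁻¹ + 1) • (Amat h q * Astar h q * Amat h q * Amat h q)
      - Astar h q * Amat h q * Amat h q * Amat h q
      = ((q : ℂ) ^ finrank F H * (1 + (q : ℂ)⁻¹) ^ 2)
        • (Amat h q * Astar h q - Astar h q * Amat h q) := by
  have hq0 : q ≠ 0 := hq ▸ Fintype.card_ne_zero
  have hq' : (q : ℂ) ≠ 0 := by exact_mod_cast hq0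
  rw [Amat_eq]
  refine tridiagonal_of_raising_lowering hq' (Rmat_mul_Astar h hq0) (Lmat_mul_Astar h hq0) ?_ ?_
  · rw [← Dmat_mul_Lpmat]
    exact lowering_relation_of_diagonal hq' (Rmat_mul_Dmat h hq0) (Lpmat_mul_Dmat h q)
      (Dmat_mul_lowering_relation h hq)
  · rw [← Dmat_mul_Lpmat]
    exact raising_relation_of_diagonal hq' (Rmat_mul_Dmat h hq0) (Lpmat_mul_Dmat h q)
      (raising_relation_mul_Dmat h hq)

theorem smul_eq_zero_of_tridiagonal {𝓐 : Type*} [Ring 𝓐] [Algebra ℂ 𝓐] {A K P Q : 𝓐}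
    {x y b c : ℂ}
    (hrel : A * A * A * K - (b + 1) • (A * A * K * A) + (b + 1) • (A * K * A * A)
      - K * A * A * A = c • (A * K - K * A))
    (hP : P * A = x • P) (hQ : A * Q = y • Q) :
    ((x - y) * (x ^ 2 - b * x * y + y ^ 2 - c)) • (P * K * Q) = 0 := by
  have hP' : ∀ X, P * (A * X) = x • (P * X) := fun X => by
    rw [← mul_assoc, hP, smul_mul_assoc]
  have := congrArg (fun X => P * X * Q) hrel
  simp only [mul_add, add_mul, mul_sub, sub_mul, mul_smul_comm, smul_mul_assoc, mul_assoc, hP',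
    hQ] at this
  rw [← sub_eq_zero] at this
  rw [mul_assoc P]
  refine Eq.trans ?_ this
  module

/-- A resolution of the identity multiplies its linear combinations as expected. -/
theorem mul_sum_smul_of_orthogonal {𝓐 : Type*} [Ring 𝓐] [Algebra ℂ 𝓐] {n : ℕ} {E : ℕ → 𝓐}
    {t : ℕ → ℂ} (horth : ∀ k l : ℕ, k ≤ n → l ≤ n → E k * E l = if k = l then E k else 0)
    {k : ℕ} (hk : k ≤ n) :
    E k * ∑ l ∈ Finset.range (n + 1), t l • E l = t k • E k
      ∧ (∑ l ∈ Finset.range (n + 1), t l • E l) * E k = t k • E k := by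
  have hmem : k ∈ Finset.range (n + 1) := Finset.mem_range.2 (by omega)
  constructor
  · rw [Finset.mul_sum, Finset.sum_eq_single_of_mem k hmem]
    · rw [mul_smul_comm, horth k k hk hk, if_pos rfl]
    · intro l hl hne
      rw [mul_smul_comm, horth k l hk (by simpa [Nat.lt_succ_iff] using hl), if_neg hne.symm,
        smul_zero]
  · rw [Finset.sum_mul, Finset.sum_eq_single_of_mem k hmem]
    · rw [smul_mul_assoc, horth k k hk hk, if_pos rfl]
    · intro l hl hne
      rw [smul_mul_assoc, horth l k (by simpa [Nat.lt_succ_iff] using hl) hk, if_neg hne,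
        smul_zero]


/-- `A*` maps the eigenspace of `A` for `θ_j` into the sum of the eigenspaces
of `A` for `θ_k` with `|k - j| ≤ 1`; equivalently `E_i A* E_j = 0` whenever
`i - j ∉ {1, 0, -1}`, where `E_k` is the spectral projection of `A` onto the eigenspace for
`θ_k`.  Half-integers `i, j, k ∈ [N]` are encoded by their doubles in `{0, …, 2N}`, and the
spectral projections are encoded by any family `E` satisfying `∑ E_k = I`,
`E_k E_l = δ_{kl} E_k` and `A = ∑ θ_k E_k`. -/
theorem stmt16 (q N M : ℕ) (hq : Fintype.card F = q) (hN : 0 < N) (hM : 0 < M)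
    (h : Submodule F H) (hH : finrank F H = N + M) (hh : finrank F h = M)
    (E : ℕ → Matrix (AttX h) (AttX h) ℂ)
    (hsum : ∑ k ∈ Finset.range (2 * N + 1), E k = 1)
    (horth : ∀ k l : ℕ, k ≤ 2 * N → l ≤ 2 * N → E k * E l = if k = l then E k else 0)
    (hspec : Amat h q = ∑ k ∈ Finset.range (2 * N + 1), ((theta q N M k : ℝ) : ℂ) • E k) :
    (∀ j : ℕ, j ≤ 2 * N →
      Submodule.map (Matrix.toLin' (Astar h q)) (eigA h q N M j)
        ≤ ⨆ k ∈ {k : ℕ | k ≤ 2 * N ∧ k ≤ j + 2 ∧ j ≤ k + 2}, eigA h q N M k) ∧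
    (∀ k l : ℕ, k ≤ 2 * N → l ≤ 2 * N → ¬(k = l ∨ k = l + 2 ∨ l = k + 2) →
      E k * Astar h q * E l = 0) := by
  have hq1 : 1 < q := hq ▸ Fintype.one_lt_card
  have hEA : ∀ k ≤ 2 * N, E k * Amat h q = ((theta q N M k : ℝ) : ℂ) • E k := fun k hk => by
    rw [hspec]
    exact (mul_sum_smul_of_orthogonal horth hk).1
  have hAE : ∀ k ≤ 2 * N, Amat h q * E k = ((theta q N M k : ℝ) : ℂ) • E k := fun k hk => by
    rw [hspec]
    exact (mul_sum_smul_of_orthogonal horth hk).2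
  have hzero : ∀ k l : ℕ, k ≤ 2 * N → l ≤ 2 * N → ¬(k = l ∨ k = l + 2 ∨ l = k + 2) →
      E k * Astar h q * E l = 0 := by
    intro k l hk hl hkl
    push Not at hkl
    have h1 := smul_eq_zero_of_tridiagonal (Amat_Astar_tridiagonal h hq) (hEA k hk) (hAE l hl)
    refine (smul_eq_zero.1 h1).resolve_left ?_
    rw [hH]
    have h2 := Complex.ofReal_ne_zero.2 (mul_ne_zero (theta_sub_ne_zero (M := M) hq1 hk hl hkl.1)
      (theta_quadratic_ne_zero (M := M) hq1 hk hl hkl.2.1 hkl.2.2))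
    push_cast at h2
    exact h2
  refine ⟨fun j hj => ?_, hzero⟩
  rintro _ ⟨v, hv, rfl⟩
  have hv' : Amat h q *ᵥ v = ((theta q N M j : ℝ) : ℂ) • v := by
    simpa [eigA, Module.End.mem_eigenspace_iff] using hv
  have hEv : ∀ k ≤ 2 * N, k ≠ j → E k *ᵥ v = 0 := by
    intro k hk hkj
    have h1 : E k *ᵥ (Amat h q *ᵥ v) = ((theta q N M k : ℝ) : ℂ) • (E k *ᵥ v) := by
      rw [mulVec_mulVec, hEA k hk, smul_mulVec]
    rw [hv', mulVec_smul, eq_comm, ← sub_eq_zero, ← sub_smul] at h1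
    refine (smul_eq_zero.1 h1).resolve_left ?_
    exact_mod_cast theta_sub_ne_zero (M := M) hq1 hk hj hkj
  have hsum' : ∀ w : AttX h → ℂ, ∑ k ∈ Finset.range (2 * N + 1), E k *ᵥ w = w := by
    intro w
    rw [← Matrix.sum_mulVec, hsum, one_mulVec]
  have hjv : E j *ᵥ v = v := by
    have hsingle := Finset.sum_eq_single_of_mem (f := fun k => E k *ᵥ v) j
      (Finset.mem_range.2 (Nat.lt_succ_of_le hj))
      fun k hk hkj => hEv k (by simpa [Nat.lt_succ_iff] using hk) hkj
    exact hsingle.symm.trans (hsum' v)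
  rw [toLin'_apply, ← hsum' (Astar h q *ᵥ v)]
  refine Submodule.sum_mem _ fun k hk => ?_
  have hk' : k ≤ 2 * N := by simpa [Nat.lt_succ_iff] using hk
  by_cases hkj : k = j ∨ k = j + 2 ∨ j = k + 2
  · have hmem : k ∈ {k : ℕ | k ≤ 2 * N ∧ k ≤ j + 2 ∧ j ≤ k + 2} := by
      rw [Set.mem_ofPred_eq]
      omega
    refine Submodule.mem_iSup_of_mem k (Submodule.mem_iSup_of_mem hmem ?_)
    rw [eigA, Module.End.mem_eigenspace_iff, toLin'_apply, mulVec_mulVec, hAE k hk', smul_mulVec]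
  · rw [← hjv, mulVec_mulVec, mulVec_mulVec, hzero k j hk' hj hkj, zero_mulVec]
    exact Submodule.zero_mem _
end
end

section
/- For all i, j ∈ [N] with |i − j| = 1, one has E_i A* E_j ≠ 0, where E_k denotes the spectral projection of A onto the eigenspace for θ_k. Equivalently, the image under A* of the eigenspace of A for θ_j is not contained in the sum of the eigenspaces of A for θ_k over k ∈ [N] with k ≠ i. -/
open Module Matrix Finset

noncomputable section

open scoped Classical

variable {F H : Type} [Field F] [Fintype F] [AddCommGroup H] [Module F H]
  [FiniteDimensional F H]

set_option linter.unusedSectionVars false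

/-- The subspace underlying a vertex. -/
def AttX.toSubmodule {h : Submodule F H} (y : AttX h) : Submodule F H := y.1

lemma AttX.inf_eq_bot {h : Submodule F H} (y : AttX h) : y.toSubmodule ⊓ h = ⊥ := y.2

lemma AttX.ext {h : Submodule F H} {y z : AttX h} (hyz : y.toSubmodule = z.toSubmodule) :
    y = z := Subtype.ext hyz

/-- A subspace avoiding `h`, as a vertex. -/
def AttX.mk {h : Submodule F H} (y : Submodule F H) (hy : y ⊓ h = ⊥) : AttX h := ⟨y, hy⟩

lemma AttX.toSubmodule_mk {h : Submodule F H} (y : Submodule F H) (hy : y ⊓ h = ⊥) :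
    (AttX.mk y hy).toSubmodule = y := rfl

lemma vdim_eq (h : Submodule F H) (y : AttX h) : vdim h y = finrank F y.toSubmodule := rfl

lemma AttCovers.le {h : Submodule F H} {y z : AttX h} (hyz : AttCovers h y z) :
    y.toSubmodule ≤ z.toSubmodule := hyz.1

/-- A subspace of a finite vector space has `q ^ dim` vectors, as a sum of indicators. -/
lemma sum_indicator_mem {W : Type} [AddCommGroup W] [Module F W] [Fintype W]
    (U : Submodule F W) :
    ∑ v : W, (if v ∈ U then (1 : ℂ) else 0) = (Fintype.card F : ℂ) ^ finrank F U := by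
  rw [Finset.sum_boole, ← Nat.cast_pow, ← Module.card_eq_pow_finrank (K := F) (V := U),
    Fintype.card_subtype]

/-- A vertex has dimension at most `N`. -/
lemma vdim_add_le (h : Submodule F H) (y : AttX h) :
    vdim h y + finrank F h ≤ finrank F H := by
  have key := Submodule.finrank_sup_add_finrank_inf_eq y.toSubmodule h
  rw [y.inf_eq_bot, finrank_bot] at key
  have := Submodule.finrank_le (y.toSubmodule ⊔ h)
  rw [vdim_eq]
  omega

lemma finrank_sup_span_singleton_of_notMem (y : Submodule F H) {v : H} (hv : v ∉ y) :
    finrank F ↥(y ⊔ F ∙ v) = finrank F y + 1 := by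
  have hv0 : v ≠ 0 := fun h0 => hv (h0 ▸ y.zero_mem)
  have hinf : y ⊓ F ∙ v = ⊥ := by
    rw [eq_bot_iff]
    rintro x ⟨hxy, hxv⟩
    obtain ⟨c, rfl⟩ := Submodule.mem_span_singleton.1 hxv
    by_cases hc : c = 0
    · simp [hc]
    · exact absurd ((Submodule.smul_mem_iff y hc).1 hxy) hv
  have key := Submodule.finrank_sup_add_finrank_inf_eq y (F ∙ v)
  rw [hinf, finrank_bot, finrank_span_singleton hv0] at key
  omega

/-- A cover of `y` containing `v ∉ y` exists, and is then `y ⊔ ⟨v⟩`, exactly when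
`v ∉ y ⊔ h`. -/
lemma sum_covers_mem (h : Submodule F H) (y : AttX h) {v : H} (hv : v ∉ y.toSubmodule) :
    ∑ z : AttX h, (if AttCovers h y z ∧ v ∈ z.toSubmodule then (1 : ℂ) else 0) =
      if v ∈ y.toSubmodule ⊔ h then 0 else 1 := by
  have hrank := finrank_sup_span_singleton_of_notMem y.toSubmodule hv
  have huniq : ∀ z : AttX h, AttCovers h y z → v ∈ z.toSubmodule → z.toSubmodule = y.toSubmodule ⊔ F ∙ v := by
    intro z hz hvz
    refine (Submodule.eq_of_le_of_finrank_eq (sup_le hz.le ?_) ?_).symm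
    · rwa [Submodule.span_singleton_le_iff_mem]
    · rw [hrank]; exact hz.2.symm
  split_ifs with hvh
  · refine Finset.sum_eq_zero fun z _ => if_neg ?_
    rintro ⟨hz, hvz⟩
    have hmod : (y.toSubmodule ⊔ h) ⊓ z.toSubmodule = y.toSubmodule := by
      rw [sup_inf_assoc_of_le h hz.le, inf_comm h, z.inf_eq_bot, sup_bot_eq]
    exact hv (hmod ▸ ⟨hvh, hvz⟩)
  · have hz0 : (y.toSubmodule ⊔ F ∙ v) ⊓ h = ⊥ := by
      rw [eq_bot_iff]
      rintro x ⟨hx, hxh⟩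
      obtain ⟨a, ha, b, hb, rfl⟩ := Submodule.mem_sup.1 hx
      obtain ⟨c, rfl⟩ := Submodule.mem_span_singleton.1 hb
      by_cases hc : c = 0
      · subst hc
        rw [← y.inf_eq_bot]
        simp only [zero_smul, add_zero] at hxh ⊢
        exact ⟨ha, hxh⟩
      · refine absurd ((Submodule.smul_mem_iff (y.toSubmodule ⊔ h) hc).1 ?_) hvh
        have : c • v = -a + (a + c • v) := by abel
        rw [this]
        exact Submodule.add_mem_sup (y.toSubmodule.neg_mem ha) hxh
    have hcov : AttCovers h y (AttX.mk (y.toSubmodule ⊔ F ∙ v) hz0) := ⟨le_sup_left, hrank⟩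
    rw [Finset.sum_eq_single (AttX.mk (y.toSubmodule ⊔ F ∙ v) hz0)]
    · exact if_pos ⟨hcov, Submodule.mem_sup_right (Submodule.mem_span_singleton_self v)⟩
    · intro z _ hz
      exact if_neg fun hc => hz (AttX.ext (huniq z hc.1 hc.2))
    · simp [AttX.toSubmodule_mk]

/-- The number of covers of a vertex. -/
lemma sum_covers (h : Submodule F H) (y : AttX h) :
    ((Fintype.card F : ℂ) - 1) * ((Fintype.card F : ℂ) ^ vdim h y *
        ∑ z : AttX h, (if AttCovers h y z then (1 : ℂ) else 0)) =
      (Fintype.card F : ℂ) ^ finrank F H - (Fintype.card F : ℂ) ^ (finrank F h + vdim h y) := by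
  have : Finite H := Module.finite_of_finite F
  let _ : Fintype H := Fintype.ofFinite H
  have hsup : finrank F ↥(y.toSubmodule ⊔ h) = finrank F h + vdim h y := by
    have key := Submodule.finrank_sup_add_finrank_inf_eq y.toSubmodule h
    rw [y.inf_eq_bot, finrank_bot] at key
    rw [vdim_eq]
    omega
  have hfib : ∀ z : AttX h, AttCovers h y z →
      ∑ v : H, (if v ∈ z.toSubmodule ∧ v ∉ y.toSubmodule then (1 : ℂ) else 0) =
        ((Fintype.card F : ℂ) - 1) * (Fintype.card F : ℂ) ^ vdim h y := by
    intro z hz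
    have hsplit : ∀ v : H, (if v ∈ z.toSubmodule ∧ v ∉ y.toSubmodule then (1 : ℂ) else 0) =
        (if v ∈ z.toSubmodule then 1 else 0) - (if v ∈ y.toSubmodule then 1 else 0) := by
      intro v
      by_cases h1 : v ∈ y.toSubmodule
      · simp [h1, hz.le h1]
      · simp [h1]
    simp_rw [hsplit]
    rw [Finset.sum_sub_distrib, sum_indicator_mem, sum_indicator_mem]
    change _ ^ vdim h z - _ ^ vdim h y = _
    rw [hz.2]
    ring
  have hout : ∑ v : H, (if v ∉ y.toSubmodule ⊔ h then (1 : ℂ) else 0) =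
      (Fintype.card F : ℂ) ^ finrank F H -
        (Fintype.card F : ℂ) ^ (finrank F h + vdim h y) := by
    have hsplit : ∀ v : H, (if v ∉ y.toSubmodule ⊔ h then (1 : ℂ) else 0) =
        (if v ∈ (⊤ : Submodule F H) then 1 else 0) - (if v ∈ y.toSubmodule ⊔ h then 1 else 0) := by
      intro v
      by_cases h1 : v ∈ y.toSubmodule ⊔ h <;> simp [h1]
    simp_rw [hsplit]
    rw [Finset.sum_sub_distrib, sum_indicator_mem, sum_indicator_mem, finrank_top, hsup]
  rw [← hout, ← mul_assoc, Finset.mul_sum]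
  calc _ = ∑ z : AttX h, ∑ v : H,
        (if v ∉ y.toSubmodule then (if AttCovers h y z ∧ v ∈ z.toSubmodule then (1 : ℂ) else 0) else 0) := by
        refine Finset.sum_congr rfl fun z _ => ?_
        by_cases hz : AttCovers h y z
        · rw [if_pos hz, mul_one, ← hfib z hz]
          refine Finset.sum_congr rfl fun v _ => ?_
          by_cases h1 : v ∈ y.toSubmodule <;> simp [h1, hz]
        · simp [hz]
    _ = ∑ v : H, ∑ z : AttX h,
        (if v ∉ y.toSubmodule then (if AttCovers h y z ∧ v ∈ z.toSubmodule then (1 : ℂ) else 0) else 0) :=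
        Finset.sum_comm
    _ = _ := by
        refine Finset.sum_congr rfl fun v _ => ?_
        by_cases h1 : v ∈ y.toSubmodule
        · simp [h1, Submodule.mem_sup_left h1]
        · simp only [h1, not_false_eq_true, if_true]
          rw [sum_covers_mem h y h1]
          by_cases h2 : v ∈ y.toSubmodule ⊔ h <;> simp [h2]

/-- The number of vertices covered by `y` that contain a subspace `w` of `y`. -/
lemma sum_covered (h : Submodule F H) (y : AttX h) {w : Submodule F H} (hw : w ≤ y.toSubmodule) :
    ((Fintype.card F : ℂ) - 1) *
        ∑ z : AttX h, (if AttCovers h z y ∧ w ≤ z.toSubmodule then (1 : ℂ) else 0) =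
      (Fintype.card F : ℂ) ^ (vdim h y - finrank F w) - 1 := by
  have : Finite (Dual F y.toSubmodule) := Module.finite_of_finite F
  let _ : Fintype (Dual F y.toSubmodule) := Fintype.ofFinite _
  have hann : ∀ u : Submodule F H, u ≤ y.toSubmodule →
      ∑ φ : Dual F y.toSubmodule, (if φ ≠ 0 ∧ u ≤ (LinearMap.ker φ).map y.toSubmodule.subtype then (1 : ℂ) else 0) =
        (Fintype.card F : ℂ) ^ (vdim h y - finrank F u) - 1 := by
    intro u hu
    have hmem : ∀ φ : Dual F y.toSubmodule, u ≤ (LinearMap.ker φ).map y.toSubmodule.subtype ↔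
        φ ∈ (u.comap y.toSubmodule.subtype).dualAnnihilator := by
      intro φ
      rw [Submodule.mem_dualAnnihilator]
      constructor
      · rintro hφ x hx
        obtain ⟨x', hx', hxx⟩ := hφ hx
        rw [← Subtype.ext hxx]
        exact hx'
      · intro hφ x hx
        exact ⟨⟨x, hu hx⟩, hφ _ hx, rfl⟩
    have hrank : finrank F (u.comap y.toSubmodule.subtype).dualAnnihilator = vdim h y - finrank F u := by
      have h1 := Subspace.finrank_add_finrank_dualAnnihilator_eq (u.comap y.toSubmodule.subtype)
      have h2 := (Submodule.comapSubtypeEquivOfLe hu).finrank_eq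
      rw [vdim_eq]
      omega
    have hsplit : ∀ φ : Dual F y.toSubmodule,
        (if φ ≠ 0 ∧ u ≤ (LinearMap.ker φ).map y.toSubmodule.subtype then (1 : ℂ) else 0) =
          (if φ ∈ (u.comap y.toSubmodule.subtype).dualAnnihilator then 1 else 0) -
            (if φ = 0 then 1 else 0) := by
      intro φ
      rw [hmem]
      by_cases h0 : φ = 0
      · simp [h0]
      · simp [h0]
    simp_rw [hsplit]
    rw [Finset.sum_sub_distrib, sum_indicator_mem, hrank]
    simp
  have hker : ∀ φ : Dual F y.toSubmodule, φ ≠ 0 →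
      finrank F ((LinearMap.ker φ).map y.toSubmodule.subtype) + 1 = vdim h y := by
    intro φ hφ
    rw [Submodule.finrank_map_subtype_eq, Module.Dual.finrank_ker_add_one_of_ne_zero hφ]
    rfl
  rw [← hann w hw, Finset.mul_sum]
  calc _ = ∑ z : AttX h, ∑ φ : Dual F y.toSubmodule,
        (if φ ≠ 0 ∧ z.toSubmodule = (LinearMap.ker φ).map y.toSubmodule.subtype ∧ w ≤ z.toSubmodule then (1 : ℂ) else 0) := by
        refine Finset.sum_congr rfl fun z _ => ?_
        by_cases hz : AttCovers h z y ∧ w ≤ z.toSubmodule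
        · have h1 : vdim h y - finrank F z.toSubmodule = 1 := by
            have := hz.1.2
            rw [vdim_eq, vdim_eq] at this
            rw [vdim_eq]
            omega
          have h2 := hann z.toSubmodule hz.1.le
          rw [h1, pow_one] at h2
          rw [if_pos hz, mul_one, ← h2]
          refine Finset.sum_congr rfl fun φ _ => if_congr ?_ rfl rfl
          refine and_congr_right fun hφ => ⟨fun hle => ⟨?_, hz.2⟩, fun he => he.1.le⟩
          refine Submodule.eq_of_le_of_finrank_eq hle ?_
          have h3 := hker φ hφ
          have h4 := hz.1.2
          change vdim h z = _
          omega
        · rw [if_neg hz, mul_zero]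
          symm
          refine Finset.sum_eq_zero fun φ _ => if_neg ?_
          rintro ⟨hφ, he, hwz⟩
          refine hz ⟨⟨?_, ?_⟩, hwz⟩
          · exact he.le.trans (Submodule.map_subtype_le _ _)
          · rw [← hker φ hφ, ← he]
            rfl
    _ = ∑ φ : Dual F y.toSubmodule, ∑ z : AttX h,
        (if φ ≠ 0 ∧ z.toSubmodule = (LinearMap.ker φ).map y.toSubmodule.subtype ∧ w ≤ z.toSubmodule then (1 : ℂ) else 0) :=
        Finset.sum_comm
    _ = _ := by
        refine Finset.sum_congr rfl fun φ _ => ?_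
        have hz0 : (LinearMap.ker φ).map y.toSubmodule.subtype ⊓ h = ⊥ :=
          eq_bot_mono (inf_le_inf_right h (Submodule.map_subtype_le _ _)) y.inf_eq_bot
        rw [Finset.sum_eq_single (AttX.mk ((LinearMap.ker φ).map y.toSubmodule.subtype) hz0)]
        · simp [AttX.toSubmodule_mk]
        · intro z _ hz
          exact if_neg fun hc => hz (AttX.ext hc.2.1)
        · simp [AttX.toSubmodule_mk]

/-- A function on the vertices, vanishing below dimension `r` but not on dimension `r`, such that
summation over the vertices covered by `y`, and over the covers of `y`, multiplies it by a factor
depending on `dim y` only. -/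
structure IsLayerFunction (h : Submodule F H) (r : ℕ) (f : AttX h → ℂ) : Prop where
  eq_zero_of_lt : ∀ y, vdim h y < r → f y = 0
  sum_down : ∀ y, ((Fintype.card F : ℂ) - 1) *
      ∑ z : AttX h, (if AttCovers h z y then f z else 0) =
    ((Fintype.card F : ℂ) ^ (vdim h y - r) - 1) * f y
  sum_up : ∀ y, ((Fintype.card F : ℂ) - 1) * ((Fintype.card F : ℂ) ^ vdim h y *
      ∑ z : AttX h, (if AttCovers h y z then f z else 0)) =
    ((Fintype.card F : ℂ) ^ finrank F H -
      (Fintype.card F : ℂ) ^ (finrank F h + vdim h y)) * f y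
  exists_ne_zero : ∃ y, vdim h y = r ∧ f y ≠ 0

lemma isLayerFunction_one (h : Submodule F H) : IsLayerFunction h 0 fun _ => 1 where
  eq_zero_of_lt y hy := absurd hy (Nat.not_lt_zero _)
  sum_down y := by
    have := sum_covered h y (w := ⊥) bot_le
    simpa using this
  sum_up y := by
    rw [mul_one]
    exact sum_covers h y
  exists_ne_zero := ⟨AttX.mk ⊥ (by simp), by rw [vdim_eq, AttX.toSubmodule_mk, finrank_bot],
    one_ne_zero⟩

/-- The indicator of the vertices containing a given vector. -/
def pointIndicator (h : Submodule F H) (v : H) (y : AttX h) : ℂ :=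
  if v ∈ y.toSubmodule then 1 else 0

lemma sum_pointIndicator_down (h : Submodule F H) {v : H} (hv : v ≠ 0) (y : AttX h) :
    ((Fintype.card F : ℂ) - 1) *
        ∑ z : AttX h, (if AttCovers h z y then pointIndicator h v z else 0) =
      ((Fintype.card F : ℂ) ^ (vdim h y - 1) - 1) * pointIndicator h v y := by
  unfold pointIndicator
  by_cases hvy : v ∈ y.toSubmodule
  · have := sum_covered h y (w := F ∙ v) (by rwa [Submodule.span_singleton_le_iff_mem])
    rw [finrank_span_singleton hv] at this
    simp only [Submodule.span_singleton_le_iff_mem] at this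
    rw [if_pos hvy, mul_one, ← this]
    simp only [ite_and]
  · rw [if_neg hvy, mul_zero, Finset.sum_eq_zero, mul_zero]
    intro z _
    split_ifs with h1 h2
    · exact absurd (h1.le h2) hvy
    · rfl
    · rfl

lemma sum_pointIndicator_up_of_mem (h : Submodule F H) {v : H} {y : AttX h}
    (hv : v ∈ y.toSubmodule) :
    ∑ z : AttX h, (if AttCovers h y z then pointIndicator h v z else 0) =
      ∑ z : AttX h, (if AttCovers h y z then (1 : ℂ) else 0) := by
  refine Finset.sum_congr rfl fun z _ => ?_
  split_ifs with hz
  · exact if_pos (hz.le hv)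
  · rfl

lemma sum_pointIndicator_up_of_notMem (h : Submodule F H) {v : H} {y : AttX h}
    (hv : v ∉ y.toSubmodule) :
    ∑ z : AttX h, (if AttCovers h y z then pointIndicator h v z else 0) =
      if v ∈ y.toSubmodule ⊔ h then 0 else 1 := by
  rw [← sum_covers_mem h y hv]
  simp only [ite_and, pointIndicator]

lemma isLayerFunction_pointIndicator_sub (h : Submodule F H) {u e : H} (hu : u ∉ h) (he : e ∈ h)
    (he0 : e ≠ 0) :
    IsLayerFunction h 1 fun y => pointIndicator h u y - pointIndicator h (u + e) y := by
  have hu0 : u ≠ 0 := fun h0 => hu (h0 ▸ h.zero_mem)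
  have hue : u + e ∉ h := fun hc => hu ((Submodule.add_mem_iff_left h he).1 hc)
  have hue0 : u + e ≠ 0 := fun h0 => hue (h0 ▸ h.zero_mem)
  have hdisj : ∀ y : AttX h, u ∈ y.toSubmodule → u + e ∉ y.toSubmodule := by
    intro y h1 h2
    have h3 : e ∈ y.toSubmodule ⊓ h := ⟨(Submodule.add_mem_iff_right _ h1).1 h2, he⟩
    rw [y.inf_eq_bot] at h3
    exact he0 h3
  have hsup : ∀ y : AttX h, u + e ∈ y.toSubmodule ⊔ h ↔ u ∈ y.toSubmodule ⊔ h := fun y =>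
    Submodule.add_mem_iff_left _ (Submodule.mem_sup_right he)
  have hsplit : ∀ (p : AttX h → Prop), ∑ z : AttX h, (if p z then
      pointIndicator h u z - pointIndicator h (u + e) z else 0) =
      ∑ z : AttX h, (if p z then pointIndicator h u z else 0) -
        ∑ z : AttX h, (if p z then pointIndicator h (u + e) z else 0) := by
    intro p
    rw [← Finset.sum_sub_distrib]
    refine Finset.sum_congr rfl fun z _ => ?_
    split_ifs <;> simp
  refine ⟨fun y hy => ?_, fun y => ?_, fun y => ?_, ?_⟩
  · have hy0 : y.toSubmodule = ⊥ := by
      rw [← Submodule.finrank_eq_zero (R := F)]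
      rw [vdim_eq] at hy
      omega
    simp [pointIndicator, hy0, hu0, hue0]
  · rw [hsplit, mul_sub, sum_pointIndicator_down h hu0, sum_pointIndicator_down h hue0, mul_sub]
  · rw [hsplit]
    by_cases h1 : u ∈ y.toSubmodule
    · have h2 := hdisj y h1
      rw [sum_pointIndicator_up_of_mem h h1, sum_pointIndicator_up_of_notMem h h2,
        if_pos ((hsup y).2 (Submodule.mem_sup_left h1)), sub_zero, sum_covers]
      simp [pointIndicator, h1, h2]
    · by_cases h2 : u + e ∈ y.toSubmodule
      · rw [sum_pointIndicator_up_of_notMem h h1, sum_pointIndicator_up_of_mem h h2,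
          if_pos ((hsup y).1 (Submodule.mem_sup_left h2)), zero_sub, mul_neg, mul_neg, sum_covers]
        simp [pointIndicator, h1, h2]
      · rw [sum_pointIndicator_up_of_notMem h h1, sum_pointIndicator_up_of_notMem h h2]
        simp [pointIndicator, h1, h2, hsup y]
  · have hbot : (F ∙ u) ⊓ h = ⊥ := by
      rw [eq_bot_iff]
      rintro x ⟨hx, hxh⟩
      obtain ⟨c, rfl⟩ := Submodule.mem_span_singleton.1 hx
      by_cases hc : c = 0
      · simp [hc]
      · exact absurd ((Submodule.smul_mem_iff h hc).1 hxh) hu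
    have hmem : u ∈ (AttX.mk (F ∙ u) hbot).toSubmodule := Submodule.mem_span_singleton_self u
    refine ⟨AttX.mk (F ∙ u) hbot, finrank_span_singleton hu0, ?_⟩
    simp [pointIndicator, hmem, hdisj _ hmem]

/-- The coefficients turning the layer function times monomials into a basis on which lowering
acts as a `q`-derivative. -/
def layerScale (q : ℂ) (n j : ℕ) : ℂ := ∏ m ∈ range j, (q ^ (m + 1) - 1) / (q ^ n - q ^ m)

/-- The vector attached to a polynomial and a layer function. -/
def layerVector (h : Submodule F H) (q : ℂ) (n r : ℕ) (f : AttX h → ℂ) (P : Polynomial ℂ) :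
    AttX h → ℂ :=
  fun y => layerScale q n (vdim h y - r) * P.coeff (vdim h y - r) * f y

lemma Amat_mulVec (h : Submodule F H) (q : ℕ) (g : AttX h → ℂ) (y : AttX h) :
    (Amat h q *ᵥ g) y = ∑ z : AttX h, (if AttCovers h z y then g z else 0) +
      (q : ℂ) ^ vdim h y * ∑ z : AttX h, (if AttCovers h y z then g z else 0) := by
  rw [Finset.mul_sum, ← Finset.sum_add_distrib]
  refine Finset.sum_congr rfl fun z _ => ?_
  unfold Amat
  by_cases h1 : AttCovers h z y
  · have h2 : ¬ AttCovers h y z := fun h2 => by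
      have := h1.2
      have := h2.2
      omega
    simp [h1, h2]
  · simp [h1]

lemma pow_sub_pow_ne_zero {q : ℕ} (hq : 1 < q) {n m : ℕ} (hnm : m ≠ n) :
    (q : ℂ) ^ n - (q : ℂ) ^ m ≠ 0 := by
  rw [sub_ne_zero]
  exact_mod_cast fun hc => hnm (Nat.pow_right_injective hq hc).symm

lemma layerScale_succ {q : ℕ} (hq : 1 < q) {n j : ℕ} (hj : j < n) :
    layerScale q n (j + 1) * ((q : ℂ) ^ n - (q : ℂ) ^ j) =
      layerScale q n j * ((q : ℂ) ^ (j + 1) - 1) := by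
  have := pow_sub_pow_ne_zero hq hj.ne
  unfold layerScale
  rw [Finset.prod_range_succ]
  field_simp

/-- A three-term recurrence for the coefficients of a polynomial makes its layer vector an
eigenvector of `A`. -/
lemma Amat_mulVec_layerVector (h : Submodule F H) {q n r M : ℕ} (hq : Fintype.card F = q)
    (hH : finrank F H = n + r + M) (hh : finrank F h = M) {f : AttX h → ℂ}
    (hf : IsLayerFunction h r f) {P : Polynomial ℂ} (hP : P.natDegree ≤ n) {t μ : ℂ}
    (ht : t ^ 2 = (q : ℂ) ^ (M + r))
    (h0 : t ^ 2 * ((q : ℂ) - 1) * P.coeff 1 = ((q : ℂ) - 1) * μ * P.coeff 0)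
    (hrec : ∀ j, ((q : ℂ) ^ n - (q : ℂ) ^ j) * P.coeff j +
      t ^ 2 * ((q : ℂ) ^ (j + 2) - 1) * P.coeff (j + 2) = ((q : ℂ) - 1) * μ * P.coeff (j + 1)) :
    Amat h q *ᵥ layerVector h q n r f P = μ • layerVector h q n r f P := by
  have hq1 : 1 < q := hq ▸ Fintype.one_lt_card
  have hqq : (q : ℂ) - 1 ≠ 0 := by
    rw [sub_ne_zero]
    exact_mod_cast hq1.ne'
  ext y
  refine mul_left_cancel₀ hqq ?_
  have hdown : ∑ z : AttX h, (if AttCovers h z y then layerVector h q n r f P z else 0) =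
      layerScale q n (vdim h y - 1 - r) * P.coeff (vdim h y - 1 - r) *
        ∑ z : AttX h, (if AttCovers h z y then f z else 0) := by
    rw [Finset.mul_sum]
    refine Finset.sum_congr rfl fun z _ => ?_
    split_ifs with hz
    · have : vdim h z = vdim h y - 1 := by
        have := hz.2
        omega
      rw [layerVector, this]
    · rw [mul_zero]
  have hup : ∑ z : AttX h, (if AttCovers h y z then layerVector h q n r f P z else 0) =
      layerScale q n (vdim h y + 1 - r) * P.coeff (vdim h y + 1 - r) *
        ∑ z : AttX h, (if AttCovers h y z then f z else 0) := by
    rw [Finset.mul_sum]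
    refine Finset.sum_congr rfl fun z _ => ?_
    split_ifs with hz
    · rw [layerVector, hz.2]
    · rw [mul_zero]
  have hsd := hf.sum_down y
  have hsu := hf.sum_up y
  have hle := vdim_add_le h y
  rw [hq] at hsd hsu
  rw [hH, hh] at hsu hle
  rw [Amat_mulVec, hdown, hup, Pi.smul_apply, smul_eq_mul]
  set d := vdim h y with hd
  have hmain : ((q : ℂ) ^ (d - r) - 1) * f y *
        (layerScale q n (d - 1 - r) * P.coeff (d - 1 - r)) +
      ((q : ℂ) ^ (n + r + M) - (q : ℂ) ^ (M + d)) * f y *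
        (layerScale q n (d + 1 - r) * P.coeff (d + 1 - r)) =
      (q - 1) * μ * (layerScale q n (d - r) * P.coeff (d - r) * f y) := by
    by_cases hdr : d < r
    · rw [hf.eq_zero_of_lt y hdr]
      ring
    · obtain ⟨j, hj⟩ : ∃ j, d = j + r := ⟨d - r, by omega⟩
      have e1 : d - r = j := by omega
      have e2 : d - 1 - r = j - 1 := by omega
      have e3 : d + 1 - r = j + 1 := by omega
      rw [e1, e2, e3, hj]
      have htop : layerScale q n (j + 1) * ((q : ℂ) ^ n - (q : ℂ) ^ j) * P.coeff (j + 1) =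
          layerScale q n j * ((q : ℂ) ^ (j + 1) - 1) * P.coeff (j + 1) := by
        rcases (show j ≤ n by omega).lt_or_eq with hjn | hjn
        · rw [layerScale_succ hq1 hjn]
        · rw [Polynomial.coeff_eq_zero_of_natDegree_lt (by omega), mul_zero, mul_zero]
      have hpow : (q : ℂ) ^ (n + r + M) - (q : ℂ) ^ (M + (j + r)) =
          t ^ 2 * ((q : ℂ) ^ n - (q : ℂ) ^ j) := by
        rw [ht]
        ring
      rw [hpow]
      rcases j with _ | j
      · simp only [zero_add, pow_zero, pow_one] at htop ⊢
        linear_combination t ^ 2 * f y * htop + layerScale q n 0 * f y * h0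
      · have hs := layerScale_succ hq1 (show j < n by omega)
        rw [Nat.add_sub_cancel]
        linear_combination t ^ 2 * f y * htop + layerScale q n (j + 1) * f y * hrec j -
          P.coeff j * f y * hs
  change _ = _ * (μ * (layerScale q n (d - r) * P.coeff (d - r) * f y))
  linear_combination hmain + layerScale q n (d - 1 - r) * P.coeff (d - 1 - r) * hsd +
    layerScale q n (d + 1 - r) * P.coeff (d + 1 - r) * hsu

lemma Astar_mulVec_layerVector (h : Submodule F H) {q : ℕ} (n : ℕ) {r : ℕ}
    {f : AttX h → ℂ} (hf : IsLayerFunction h r f) (P : Polynomial ℂ) :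
    Astar h q *ᵥ layerVector h q n r f P =
      ((q : ℂ)⁻¹ ^ r) • layerVector h q n r f (P.comp (.C (q : ℂ)⁻¹ * .X)) := by
  ext y
  rw [Astar, Matrix.mulVec_diagonal, Pi.smul_apply, smul_eq_mul]
  unfold layerVector
  by_cases hdr : vdim h y < r
  · simp [hf.eq_zero_of_lt y hdr]
  · obtain ⟨j, hj⟩ : ∃ j, vdim h y = j + r := ⟨vdim h y - r, by omega⟩
    rw [hj, Nat.add_sub_cancel, Polynomial.comp_C_mul_X_coeff, _root_.zpow_neg, zpow_natCast, pow_add,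
      mul_inv, inv_pow, inv_pow]
    ring

lemma layerVector_combination (h : Submodule F H) (q : ℂ) (n r : ℕ) (f : AttX h → ℂ)
    (α β γ : ℂ) (P Q R : Polynomial ℂ) :
    layerVector h q n r f (.C α * P + .C β * Q + .C γ * R) =
      α • layerVector h q n r f P + β • layerVector h q n r f Q +
        γ • layerVector h q n r f R := by
  ext y
  simp only [layerVector, Polynomial.coeff_add, Polynomial.coeff_C_mul, Pi.add_apply,
    Pi.smul_apply, smul_eq_mul]
  ring

lemma layerVector_ne_zero (h : Submodule F H) (q : ℂ) (n : ℕ) {r : ℕ} {f : AttX h → ℂ}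
    (hf : IsLayerFunction h r f) {P : Polynomial ℂ} (hP : P.coeff 0 ≠ 0) :
    layerVector h q n r f P ≠ 0 := by
  obtain ⟨y, hy, hfy⟩ := hf.exists_ne_zero
  intro hc
  have := congrFun hc y
  simp [layerVector, hy, layerScale, hP, hfy] at this

/-- The polynomial encoding an eigenvector of `A`. -/
def eigenPoly (q t : ℂ) (a b : ℕ) : Polynomial ℂ :=
  (∏ m ∈ range a, (.C t - .C (q ^ m) * .X)) * ∏ m ∈ range b, (.C t + .C (q ^ m) * .X)

lemma eval_eigenPoly (q t x : ℂ) (a b : ℕ) : (eigenPoly q t a b).eval x =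
    (∏ m ∈ range a, (t - q ^ m * x)) * ∏ m ∈ range b, (t + q ^ m * x) := by
  simp [eigenPoly, Polynomial.eval_prod]

lemma natDegree_eigenPoly_le (q t : ℂ) (a b : ℕ) : (eigenPoly q t a b).natDegree ≤ a + b := by
  have hlin : ∀ c : ℂ, (.C t + .C c * .X : Polynomial ℂ).natDegree ≤ 1 := fun c => by
    rw [add_comm]
    exact Polynomial.natDegree_linear_le
  refine Polynomial.natDegree_mul_le.trans (add_le_add ?_ ?_)
  · refine (Polynomial.natDegree_prod_le _ _).trans ((Finset.sum_le_card_nsmul _ _ 1 ?_).trans ?_)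
    · intro m _
      simpa [sub_eq_add_neg] using hlin (-(q ^ m))
    · simp
  · refine (Polynomial.natDegree_prod_le _ _).trans ((Finset.sum_le_card_nsmul _ _ 1 ?_).trans ?_)
    · intro m _
      exact hlin (q ^ m)
    · simp

lemma coeff_zero_eigenPoly (q t : ℂ) (a b : ℕ) : (eigenPoly q t a b).coeff 0 = t ^ (a + b) := by
  rw [Polynomial.coeff_zero_eq_eval_zero, eval_eigenPoly]
  simp [pow_add]

lemma eigenPoly_comp_mul (q t : ℂ) (a b : ℕ) :
    (eigenPoly q t a b).comp (.C q * .X) * (.C (t ^ 2) - .X * .X) =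
      eigenPoly q t a b *
        (.C (t ^ 2) + .C (t * (q ^ b - q ^ a)) * .X - .C (q ^ (a + b)) * .X * .X) := by
  refine Polynomial.funext fun x => ?_
  have h1 := (Finset.prod_range_succ' (fun m => t - q ^ m * x) a).symm.trans
    (Finset.prod_range_succ _ _)
  have h2 := (Finset.prod_range_succ' (fun m => t + q ^ m * x) b).symm.trans
    (Finset.prod_range_succ _ _)
  simp only [Polynomial.eval_mul, Polynomial.eval_comp, Polynomial.eval_sub, Polynomial.eval_add,
    Polynomial.eval_C, Polynomial.eval_X, eval_eigenPoly, ← mul_assoc, ← pow_succ]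
  simp only [pow_zero, one_mul] at h1 h2
  have h3 := congrArg₂ (· * ·) h1 h2
  linear_combination h3

lemma eigenPoly_coeff_one (q t : ℂ) (a b : ℕ) :
    t ^ 2 * (q - 1) * (eigenPoly q t a b).coeff 1 =
      t * (q ^ b - q ^ a) * (eigenPoly q t a b).coeff 0 := by
  have key := congrArg (Polynomial.coeff · 1) (eigenPoly_comp_mul q t a b)
  simp only [mul_sub, mul_add, ← mul_assoc, Polynomial.coeff_sub, Polynomial.coeff_add,
    Polynomial.coeff_mul_X, Polynomial.coeff_mul_C, Polynomial.comp_C_mul_X_coeff,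
    Polynomial.coeff_mul_X_zero] at key
  linear_combination key

lemma eigenPoly_coeff_add_two (q t : ℂ) (a b j : ℕ) :
    (q ^ (a + b) - q ^ j) * (eigenPoly q t a b).coeff j +
        t ^ 2 * (q ^ (j + 2) - 1) * (eigenPoly q t a b).coeff (j + 2) =
      t * (q ^ b - q ^ a) * (eigenPoly q t a b).coeff (j + 1) := by
  have key := congrArg (Polynomial.coeff · (j + 2)) (eigenPoly_comp_mul q t a b)
  simp only [mul_sub, mul_add, ← mul_assoc, Polynomial.coeff_sub, Polynomial.coeff_add,
    Polynomial.coeff_mul_X, Polynomial.coeff_mul_C, Polynomial.comp_C_mul_X_coeff] at key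
  linear_combination key

/-- Scaling the variable by `q⁻¹` acts on the eigenvector polynomials by an irreducible
three-term recurrence. -/
lemma eigenPoly_comp_inv {q : ℕ} (hq : 1 < q) (t : ℂ) (a b : ℕ) :
    ∃ α β γ : ℂ, (eigenPoly q t a b).comp (.C (q : ℂ)⁻¹ * .X) =
        .C α * eigenPoly q t (a - 1) (b + 1) + .C β * eigenPoly q t a b +
          .C γ * eigenPoly q t (a + 1) (b - 1) ∧ (α = 0 ↔ a = 0) ∧ (γ = 0 ↔ b = 0) := by
  have hpos : ∀ m n : ℕ, (q : ℂ) ^ m + (q : ℂ) ^ n ≠ 0 := fun m n => by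
    have : 0 < q ^ m + q ^ n := by positivity
    exact_mod_cast this.ne'
  have hone : ∀ m : ℕ, (q : ℂ) ^ (2 * m) - 1 = 0 ↔ m = 0 := fun m => by
    constructor
    · intro hm
      by_contra hm0
      exact pow_sub_pow_ne_zero hq (n := 2 * m) (m := 0) (by omega) (by simpa using hm)
    · rintro rfl
      simp
  have hq0 : (q : ℂ) ≠ 0 := by
    exact_mod_cast (by omega : q ≠ 0)
  have hab := hpos a b
  have hab' := hpos a (b + 1)
  have hba := hpos b (a + 1)
  refine ⟨((q : ℂ) ^ (2 * a) - 1) / (((q : ℂ) ^ a + (q : ℂ) ^ b) * ((q : ℂ) ^ a + (q : ℂ) ^ (b + 1))),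
    1 - ((q : ℂ) ^ (2 * a) - 1) / (((q : ℂ) ^ a + (q : ℂ) ^ b) * ((q : ℂ) ^ a + (q : ℂ) ^ (b + 1))) -
      ((q : ℂ) ^ (2 * b) - 1) / (((q : ℂ) ^ a + (q : ℂ) ^ b) * ((q : ℂ) ^ b + (q : ℂ) ^ (a + 1))),
    ((q : ℂ) ^ (2 * b) - 1) / (((q : ℂ) ^ a + (q : ℂ) ^ b) * ((q : ℂ) ^ b + (q : ℂ) ^ (a + 1))),
    ?_, ?_, ?_⟩
  · refine Polynomial.funext fun x => ?_
    have hminus : ∀ c : ℕ, ∏ m ∈ range (c + 1), (t - (q : ℂ) ^ m * ((q : ℂ)⁻¹ * x)) =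
        (∏ m ∈ range c, (t - (q : ℂ) ^ m * x)) * (t - (q : ℂ)⁻¹ * x) := fun c => by
      rw [Finset.prod_range_succ', pow_zero, one_mul]
      congr 1
      refine Finset.prod_congr rfl fun m _ => ?_
      rw [pow_succ, mul_assoc, mul_inv_cancel_left₀ hq0]
    have hplus : ∀ c : ℕ, ∏ m ∈ range (c + 1), (t + (q : ℂ) ^ m * ((q : ℂ)⁻¹ * x)) =
        (∏ m ∈ range c, (t + (q : ℂ) ^ m * x)) * (t + (q : ℂ)⁻¹ * x) := fun c => by
      rw [Finset.prod_range_succ', pow_zero, one_mul]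
      congr 1
      refine Finset.prod_congr rfl fun m _ => ?_
      rw [pow_succ, mul_assoc, mul_inv_cancel_left₀ hq0]
    simp only [Polynomial.eval_mul, Polynomial.eval_comp, Polynomial.eval_add,
      Polynomial.eval_C, Polynomial.eval_X, eval_eigenPoly]
    rcases a with _ | a <;> rcases b with _ | b
    · simp
    · simp only [hplus, Finset.prod_range_succ, Nat.add_sub_cancel, Finset.prod_range_zero]
      generalize ∏ m ∈ range b, (t + (q : ℂ) ^ m * x) = Q
      have hB1 := hpos 0 b
      have hB2 := hpos 0 (b + 1)
      have hB3 := hpos b 0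
      simp only [pow_mul', pow_succ', pow_zero, mul_zero] at hB1 hB2 hB3 hab' ⊢
      generalize (q : ℂ) ^ b = B at *
      field_simp
      ring
    · simp only [hminus, Finset.prod_range_succ, Nat.add_sub_cancel, Finset.prod_range_zero]
      generalize ∏ m ∈ range a, (t - (q : ℂ) ^ m * x) = Q
      have hA1 := hpos a 0
      have hA2 := hpos 0 (a + 1)
      have hA3 := hpos (a + 1) 0
      simp only [pow_mul', pow_succ', pow_zero, mul_zero] at hA1 hA2 hA3 hba ⊢
      generalize (q : ℂ) ^ a = A at *
      field_simp
      ring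
    · simp only [hminus, hplus, Finset.prod_range_succ, Nat.add_sub_cancel]
      generalize ∏ m ∈ range a, (t - (q : ℂ) ^ m * x) = P
      generalize ∏ m ∈ range b, (t + (q : ℂ) ^ m * x) = Q
      have h1 := hpos a b
      have h2 := hpos a (b + 1)
      have h3 := hpos b (a + 1)
      simp only [pow_mul', pow_succ', pow_zero] at h1 h2 h3 ⊢
      generalize (q : ℂ) ^ a = A at *
      generalize (q : ℂ) ^ b = B at *
      field_simp
      ring
  · rw [div_eq_zero_iff, or_iff_left (mul_ne_zero hab hab'), hone]
  · rw [div_eq_zero_iff, or_iff_left (mul_ne_zero hab hba), hone]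

lemma theta_injOn {q N M : ℕ} (hq : 1 < q) {k m : ℕ} (hk : k ≤ 2 * N) (hm : m ≤ 2 * N)
    (hkm : theta q N M k = theta q N M m) : k = m := by
  have hs : 1 < Real.sqrt q := by
    rw [Real.lt_sqrt zero_le_one]
    exact_mod_cast (by omega : 1 ^ 2 < q)
  have hq1 : (0 : ℝ) < q - 1 := by
    rw [sub_pos]
    exact_mod_cast hq
  have hpos : 0 < Real.sqrt q ^ M := by positivity
  have hlt : ∀ i j : ℕ, i < j → j ≤ 2 * N → theta q N M j < theta q N M i := by
    intro i j hij hj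
    refine mul_lt_mul_of_pos_right (div_lt_div_of_pos_right ?_ hq1) hpos
    exact sub_lt_sub (pow_lt_pow_right₀ hs (by omega)) (pow_lt_pow_right₀ hs hij)
  rcases lt_trichotomy k m with h1 | h1 | h1
  · exact absurd hkm (hlt k m h1 hm).ne'
  · exact h1
  · exact absurd hkm (hlt m k h1 hk).ne

lemma theta_two_mul_add {q : ℕ} (hq : (q : ℂ) - 1 ≠ 0) (M r a b : ℕ) :
    ((theta q (a + b + r) M (2 * a + r) : ℝ) : ℂ) * ((q : ℂ) - 1) =
      ((Real.sqrt q ^ (M + r) : ℝ) : ℂ) * ((q : ℂ) ^ b - (q : ℂ) ^ a) := by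
  have hq' : (q : ℝ) - 1 ≠ 0 := fun hc => hq (by exact_mod_cast congrArg ((↑) : ℝ → ℂ) hc)
  have hsq : Real.sqrt q ^ 2 = q := Real.sq_sqrt (Nat.cast_nonneg q)
  have hreal : theta q (a + b + r) M (2 * a + r) * ((q : ℝ) - 1) =
      Real.sqrt q ^ (M + r) * ((q : ℝ) ^ b - (q : ℝ) ^ a) := by
    have he : 2 * (a + b + r) - (2 * a + r) = 2 * b + r := by omega
    rw [theta, he, pow_add _ (2 * b), pow_add _ (2 * a), pow_mul, pow_mul, hsq]
    field_simp
    ring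
  exact_mod_cast congrArg ((↑) : ℝ → ℂ) hreal

/-- The spectral projections act on eigenvectors by Kronecker deltas. -/
lemma spectral_mulVec {ι : Type} [Fintype ι] {n : ℕ} {A : Matrix ι ι ℂ} {θ : ℕ → ℂ}
    {E : ℕ → Matrix ι ι ℂ} (hθ : Set.InjOn θ (range n)) (hsum : ∑ k ∈ range n, E k = 1)
    (horth : ∀ k ∈ range n, ∀ l ∈ range n, E k * E l = if k = l then E k else 0)
    (hspec : A = ∑ k ∈ range n, θ k • E k) {m : ℕ} (hm : m ∈ range n) {w : ι → ℂ}
    (hw : A *ᵥ w = θ m • w) {k : ℕ} (hk : k ∈ range n) :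
    E k *ᵥ w = if k = m then w else 0 := by
  have hmul : ∀ k ∈ range n, E k * A = θ k • E k := by
    intro k hk
    rw [hspec, Finset.mul_sum, Finset.sum_eq_single k]
    · rw [mul_smul_comm, horth k hk k hk, if_pos rfl]
    · intro l hl hlk
      rw [mul_smul_comm, horth k hk l hl, if_neg hlk.symm, smul_zero]
    · exact fun hc => absurd hk hc
  have hzero : ∀ k ∈ range n, k ≠ m → E k *ᵥ w = 0 := by
    intro k hk hkm
    have h1 : θ k • (E k *ᵥ w) = θ m • (E k *ᵥ w) := by
      rw [← Matrix.smul_mulVec, ← hmul k hk, ← Matrix.mulVec_mulVec, hw, Matrix.mulVec_smul]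
    rw [← sub_eq_zero, ← sub_smul] at h1
    exact (smul_eq_zero.1 h1).resolve_left (sub_ne_zero.2 fun hc => hkm (hθ hk hm hc))
  split_ifs with hkm
  · subst hkm
    have h1 : (∑ l ∈ range n, E l) *ᵥ w = w := by rw [hsum, Matrix.one_mulVec]
    rwa [Matrix.sum_mulVec, Finset.sum_eq_single k (fun l hl hlk => hzero l hl hlk)
      (fun hc => absurd hk hc)] at h1
  · exact hzero k hk hkm

/-- An eigenvector of `A` for `θ_{a + r/2}`. -/
lemma Amat_mulVec_eigenPoly (h : Submodule F H) {q r a b M : ℕ} (hq : Fintype.card F = q)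
    (hH : finrank F H = a + b + r + M) (hh : finrank F h = M) {f : AttX h → ℂ}
    (hf : IsLayerFunction h r f) :
    Amat h q *ᵥ layerVector h q (a + b) r f
        (eigenPoly q ((Real.sqrt q ^ (M + r) : ℝ) : ℂ) a b) =
      ((theta q (a + b + r) M (2 * a + r) : ℝ) : ℂ) • layerVector h q (a + b) r f
        (eigenPoly q ((Real.sqrt q ^ (M + r) : ℝ) : ℂ) a b) := by
  have hq1 : 1 < q := hq ▸ Fintype.one_lt_card
  have hqq : (q : ℂ) - 1 ≠ 0 := by
    rw [sub_ne_zero]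
    exact_mod_cast hq1.ne'
  have hθ := theta_two_mul_add hqq M r a b
  rw [mul_comm] at hθ
  refine Amat_mulVec_layerVector h hq hH hh hf (natDegree_eigenPoly_le _ _ _ _)
    (t := ((Real.sqrt q ^ (M + r) : ℝ) : ℂ)) ?_ ?_ fun j => ?_
  · rw [← Complex.ofReal_pow, ← pow_mul, mul_comm, pow_mul, Real.sq_sqrt (Nat.cast_nonneg q)]
    norm_cast
  · rw [hθ]
    exact eigenPoly_coeff_one _ _ _ _
  · rw [hθ]
    exact eigenPoly_coeff_add_two _ _ _ _ _

/-- Nonvanishing of `E_k A* E_l` for adjacent `k`, `l` of the parity of `r`, given a layer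
function starting in dimension `r`. -/
lemma proj_mul_Astar_mul_proj_ne_zero {q n r M : ℕ} (hq : Fintype.card F = q)
    (h : Submodule F H) (hH : finrank F H = n + r + M) (hh : finrank F h = M)
    {f : AttX h → ℂ} (hf : IsLayerFunction h r f) (E : ℕ → Matrix (AttX h) (AttX h) ℂ)
    (hE : ∀ k m : ℕ, k ≤ 2 * (n + r) → m ≤ 2 * (n + r) → ∀ w : AttX h → ℂ,
      Amat h q *ᵥ w = ((theta q (n + r) M m : ℝ) : ℂ) • w → E k *ᵥ w = if k = m then w else 0)
    {i j : ℕ} (hi : i ≤ n) (hj : j ≤ n) (hij : i = j + 1 ∨ j = i + 1) :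
    E (2 * i + r) * Astar h q * E (2 * j + r) ≠ 0 := by
  have hq1 : 1 < q := hq ▸ Fintype.one_lt_card
  have hq0 : (q : ℂ) ≠ 0 := by
    exact_mod_cast (by omega : q ≠ 0)
  set t : ℂ := ((Real.sqrt q ^ (M + r) : ℝ) : ℂ) with ht
  have ht0 : t ≠ 0 := by
    have : 0 < Real.sqrt q := Real.sqrt_pos.2 (by exact_mod_cast (by omega : 0 < q))
    rw [ht]
    exact_mod_cast (pow_pos this _).ne'
  set v : ℕ → ℕ → AttX h → ℂ := fun a b => layerVector h q n r f (eigenPoly q t a b) with hv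
  have hproj : ∀ k ≤ n, ∀ a b, a + b = n →
      E (2 * k + r) *ᵥ v a b = if k = a then v a b else 0 := by
    rintro k hk a b rfl
    rw [hE (2 * k + r) (2 * a + r) (by omega) (by omega) _ (Amat_mulVec_eigenPoly h hq hH hh hf)]
    exact if_congr (by omega) rfl rfl
  have hv0 : v i (n - i) ≠ 0 := layerVector_ne_zero h q n hf (by
    rw [coeff_zero_eigenPoly]
    exact pow_ne_zero _ ht0)
  intro hzero
  have h1 : (E (2 * i + r) * Astar h q * E (2 * j + r)) *ᵥ v j (n - j) = 0 := by
    rw [hzero, Matrix.zero_mulVec]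
  obtain ⟨α, β, γ, hpoly, hα, hγ⟩ := eigenPoly_comp_inv hq1 t j (n - j)
  rw [← Matrix.mulVec_mulVec, hproj j hj j _ (by omega), if_pos rfl, ← Matrix.mulVec_mulVec,
    hv, Astar_mulVec_layerVector h n hf, hpoly, layerVector_combination, Matrix.mulVec_smul,
    smul_eq_zero, or_iff_right (pow_ne_zero _ (inv_ne_zero hq0)), Matrix.mulVec_add,
    Matrix.mulVec_add, Matrix.mulVec_smul, Matrix.mulVec_smul, Matrix.mulVec_smul] at h1
  change α • (_ *ᵥ v (j - 1) (n - j + 1)) + β • (_ *ᵥ v j (n - j)) +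
    γ • (_ *ᵥ v (j + 1) (n - j - 1)) = 0 at h1
  rw [hproj i hi j _ (by omega), if_neg (by omega), smul_zero, add_zero] at h1
  rcases hij with rfl | rfl
  · have hleft : α • (E (2 * (j + 1) + r) *ᵥ v (j - 1) (n - j + 1)) = 0 := by
      rcases Nat.eq_zero_or_pos j with h0 | h0
      · rw [hα.2 h0, zero_smul]
      · rw [hproj _ hi _ _ (by omega), if_neg (by omega), smul_zero]
    rw [hleft, zero_add, hproj _ hi _ _ (by omega), if_pos rfl, smul_eq_zero, hγ] at h1
    exact h1.elim (by omega) hv0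
  · have hright : γ • (E (2 * i + r) *ᵥ v (i + 1 + 1) (n - (i + 1) - 1)) = 0 := by
      rcases Nat.eq_zero_or_pos (n - (i + 1)) with h0 | h0
      · rw [hγ.2 h0, zero_smul]
      · rw [hproj _ hi _ _ (by omega), if_neg (by omega), smul_zero]
    rw [hright, add_zero, Nat.add_sub_cancel, hproj _ hi _ _ (by omega), if_pos rfl, smul_eq_zero,
      hα, (by omega : n - (i + 1) + 1 = n - i)] at h1
    exact h1.elim (by omega) hv0

/-- for `i, j ∈ [N]` with `|i - j| = 1` one has `E_i A* E_j ≠ 0`, where `E_k`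
is the spectral projection of `A` onto the eigenspace for `θ_k`.  Half-integers are encoded
by their doubles in `{0, …, 2N}` (so `|i - j| = 1` becomes `|k - l| = 2`), and the spectral
projections are encoded by any family `E` satisfying `∑ E_k = I`, `E_k E_l = δ_{kl} E_k`
and `A = ∑ θ_k E_k`. -/
theorem stmt17 (q N M : ℕ) (hq : Fintype.card F = q) (hN : 0 < N) (hM : 0 < M)
    (h : Submodule F H) (hH : finrank F H = N + M) (hh : finrank F h = M)
    (E : ℕ → Matrix (AttX h) (AttX h) ℂ)
    (hsum : ∑ k ∈ Finset.range (2 * N + 1), E k = 1)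
    (horth : ∀ k l : ℕ, k ≤ 2 * N → l ≤ 2 * N → E k * E l = if k = l then E k else 0)
    (hspec : Amat h q = ∑ k ∈ Finset.range (2 * N + 1), ((theta q N M k : ℝ) : ℂ) • E k)
    (k l : ℕ) (hk : k ≤ 2 * N) (hl : l ≤ 2 * N) (hkl : k = l + 2 ∨ l = k + 2) :
    E k * Astar h q * E l ≠ 0 := by
  have hq1 : 1 < q := hq ▸ Fintype.one_lt_card
  have hE : ∀ k m : ℕ, k ≤ 2 * N → m ≤ 2 * N → ∀ w : AttX h → ℂ,
      Amat h q *ᵥ w = ((theta q N M m : ℝ) : ℂ) • w → E k *ᵥ w = if k = m then w else 0 := by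
    intro k m hk hm w hw
    refine spectral_mulVec (θ := fun k => ((theta q N M k : ℝ) : ℂ)) ?_ hsum ?_ hspec
      (Finset.mem_range_succ_iff.2 hm) hw (Finset.mem_range_succ_iff.2 hk)
    · intro a ha b hb hab
      rw [Finset.mem_coe, Finset.mem_range_succ_iff] at ha hb
      exact theta_injOn hq1 ha hb (Complex.ofReal_injective hab)
    · intro a ha b hb
      rw [Finset.mem_range_succ_iff] at ha hb
      exact horth a b ha hb
  rcases Nat.even_or_odd' k with ⟨i, rfl | rfl⟩
  · obtain ⟨j, rfl⟩ : ∃ j, l = 2 * j := ⟨l / 2, by omega⟩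
    exact proj_mul_Astar_mul_proj_ne_zero (n := N) (r := 0) hq h hH hh (isLayerFunction_one h) E hE
      (i := i) (j := j) (by omega) (by omega) (by omega)
  · obtain ⟨j, rfl⟩ : ∃ j, l = 2 * j + 1 := ⟨l / 2, by omega⟩
    obtain ⟨n, rfl⟩ : ∃ n, N = n + 1 := ⟨N - 1, by omega⟩
    have hbot : h ≠ ⊥ := by
      rintro rfl
      rw [finrank_bot] at hh
      omega
    have htop : h < ⊤ := by
      rw [lt_top_iff_ne_top]
      rintro rfl
      rw [finrank_top] at hh
      omega
    obtain ⟨e, he, he0⟩ := Submodule.exists_mem_ne_zero_of_ne_bot hbot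
    obtain ⟨u, -, hu⟩ := SetLike.exists_of_lt htop
    exact proj_mul_Astar_mul_proj_ne_zero (n := n) (r := 1) hq h hH hh
      (isLayerFunction_pointIndicator_sub h hu he he0) E hE (i := i) (j := j)
      (by omega) (by omega) (by omega)
end
end
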